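/- Let D ∈ CD_{n,k} be a chord diagram, C a domino matrix of D satisfying the sign rules, Z ∈ Mat_{n×(k+4)}(ℝ) positive, and Y = CZ. Then: (1) ⟨Y i i+1 j j+1⟩ > 0 for all 1 ≤ i < i+1 < j < j+1 ≤ n, and (−1)^k·⟨Y 1 i i+1 n⟩ > 0 for all 2 ≤ i with i+1 ≤ n−1. (2) If c_l = (i, i+1, j, j+1) is a top chord of D (l its index in the start-increasing ordering of the chords) and p ∈ {i, i+1, j, j+1, n}, then the twistor whose four Z-row indices are the elements of {i, i+1, j, j+1, n}∖{p} in increasing order is nonzero and has sign: +1 if p = n; (−1)^{k−l} if p = i; (−1)^{k−l+1} if p = i+1; (−1)^{k−l−below(c_l)} if p = j; and (−1)^{k−l−below(c_l)+1} if p = j+1. -/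

import Mathlib

open scoped Classical

noncomputable section

/-- A rectangular `n × r` matrix (with `r ≤ n`) is *positive* if all of its maximal
`r × r` minors (rows selected in increasing order) have positive determinant. -/
def IsPositiveMatrix {n r : ℕ} (Z : Matrix (Fin n) (Fin r) ℝ) : Prop :=
  ∀ f : Fin r → Fin n, StrictMono f → 0 < (Z.submatrix f id).det

/-- A `k × n` matrix is *totally nonnegative* if all of its `k × k` minors
(columns selected in increasing order) have nonnegative determinant. -/
def IsTotallyNonnegRect {k n : ℕ} (C : Matrix (Fin k) (Fin n) ℝ) : Prop :=
  ∀ g : Fin k → Fin n, StrictMono g → 0 ≤ (C.submatrix id g).det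

/-- The row of `Z` whose (1-based) marker is `p`, i.e. the row with index `p - 1`. -/
def markerRow {n r : ℕ} (Z : Matrix (Fin n) (Fin r) ℝ) (p : ℕ) : Fin r → ℝ :=
  if h : p - 1 < n then Z ⟨p - 1, h⟩ else 0

/-- The twistor coordinate `⟨Y a₁ a₂ a₃ a₄⟩`: the determinant of the `(k+4) × (k+4)` matrix
whose rows are the `k` rows of `Y` followed by the rows of `Z` with (1-based) markers
`a 0, a 1, a 2, a 3`. -/
def twistor {n k : ℕ} (Z : Matrix (Fin n) (Fin (k + 4)) ℝ)
    (Y : Matrix (Fin k) (Fin (k + 4)) ℝ) (a : Fin 4 → ℕ) : ℝ :=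
  ((Matrix.fromRows Y (Matrix.of fun t => markerRow Z (a t))).submatrix
    (⇑finSumFinEquiv.symm) id).det

/-- The row space of a matrix: the span of its rows. -/
def rowSpace {k n : ℕ} (A : Matrix (Fin k) (Fin n) ℝ) : Submodule ℝ (Fin n → ℝ) :=
  Submodule.span ℝ (Set.range fun r => A r)

/-- The minor of `A` on the set of rows `S` (taken in increasing order), using all columns;
defined to be `0` if `S` does not have the right cardinality. -/
def rowMinor {N r : ℕ} (A : Matrix (Fin N) (Fin r) ℝ) (S : Finset (Fin N)) : ℝ :=
  if h : S.card = r then (A.submatrix (fun t => (S.orderIsoOfFin h t).1) id).det else 0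

/-- The minor of `C` on the set of columns `J` (taken in increasing order), using all rows;
defined to be `0` if `J` does not have the right cardinality. -/
def colMinor {k N : ℕ} (C : Matrix (Fin k) (Fin N) ℝ) (J : Finset (Fin N)) : ℝ :=
  if h : J.card = k then (C.submatrix id (fun t => (J.orderIsoOfFin h t).1)).det else 0


/-- A chord diagram with `n` markers (labelled `1, …, n`) and `k` chords
`c_l = (tail l, tail l + 1, head l, head l + 1)`. -/
structure ChordDiagram (n k : ℕ) where
  tail : Fin k → ℕ
  head : Fin k → ℕ
  one_le_tail : ∀ l, 1 ≤ tail l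
  tail_add_two_le_head : ∀ l, tail l + 2 ≤ head l
  head_add_two_le : ∀ l, head l + 2 ≤ n
  tail_strictMono : StrictMono tail
  noncrossing : ∀ l m : Fin k, l < m → ¬(tail m < head l ∧ head l < head m)

namespace ChordDiagram

variable {n k : ℕ} (D : ChordDiagram n k)

/-- `c_m` is a descendant of `c_l`. -/
def Descendant (l m : Fin k) : Prop := D.tail l < D.tail m ∧ D.head m ≤ D.head l

/-- The number of descendants of `c_l`. -/
def below (l : Fin k) : ℕ := (Finset.univ.filter fun m => D.Descendant l m).card

/-- `c_l` is a top chord: it has no ancestor. -/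
def IsTop (l : Fin k) : Prop := ∀ m, ¬ D.Descendant m l

/-- `c_m` is the parent of `c_l`: the ancestor of `c_l` with the largest start. -/
def IsParent (m l : Fin k) : Prop :=
  D.Descendant m l ∧ ∀ m', D.Descendant m' l → D.tail m' ≤ D.tail m

/-- The number of chords starting after the start of `c_l` (equals `k - l` for the
`l`-th chord in the 1-based start-increasing ordering). -/
def behind (l : Fin k) : ℕ := (Finset.univ.filter fun m => D.tail l < D.tail m).card

/-- The number of descendants of `c_m` (the parent of `c_l`) that come before `c_l`
(equals `l - m - 1` in the 1-based start-increasing ordering). -/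
def beyond (l m : Fin k) : ℕ :=
  (Finset.univ.filter fun h => D.Descendant m h ∧ D.tail h < D.tail l).card

/-- The domino matrix of `D` with variables `α, β, γ, δ, ε` : the column with (0-based)
index `a` corresponds to the (1-based) marker `a + 1`. -/
def dominoMatrix (α β γ δ ε : Fin k → ℝ) : Matrix (Fin k) (Fin n) ℝ :=
  Matrix.of fun l a =>
    (if (a : ℕ) + 1 = D.tail l then α l else 0) +
    (if (a : ℕ) + 1 = D.tail l + 1 then β l else 0) +
    (if (a : ℕ) + 1 = D.head l then γ l else 0) +
    (if (a : ℕ) + 1 = D.head l + 1 then δ l else 0) +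
    (if D.IsTop l ∧ (a : ℕ) + 1 = n then ε l else 0) +
    (∑ m : Fin k, if D.IsParent m l then
        (if (a : ℕ) + 1 = D.tail m then ε l * α m else 0) +
        (if (a : ℕ) + 1 = D.tail m + 1 then ε l * β m else 0)
      else 0)

/-- The sign rules for the domino variables of `D`. -/
def SignRules (α β γ δ ε : Fin k → ℝ) : Prop :=
  (∀ l, 0 < α l) ∧ (∀ l, 0 < β l) ∧
  (∀ l, 0 < (-1 : ℝ) ^ D.below l * γ l) ∧
  (∀ l, 0 < (-1 : ℝ) ^ D.below l * δ l) ∧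
  (∀ l, D.IsTop l → 0 < (-1 : ℝ) ^ D.behind l * ε l) ∧
  (∀ l m, D.IsParent m l → 0 < (-1 : ℝ) ^ D.beyond l m * ε l) ∧
  (∀ l m, D.IsParent m l → D.head l = D.head m → δ l / γ l < δ m / γ m) ∧
  (∀ l m, D.head m = D.tail l → δ m / γ m < β l / α l)

end ChordDiagram

/-- The row with entries `a`, `b` in columns `p`, `p + 1` and zeros elsewhere. -/
def dominoRow (p : ℕ) (a b : ℝ) (c : ℕ) : ℝ :=
  (if c = p then a else 0) + (if c = p + 1 then b else 0)

/-- The square matrix whose `r`-th row is the domino `(a r, b r)` at position `p r`, restricted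
to the columns `c`. -/
def dominoMinor {N : ℕ} (p : Fin N → ℕ) (a b : Fin N → ℝ) (c : Fin N → ℕ) :
    Matrix (Fin N) (Fin N) ℝ :=
  Matrix.of fun r t => dominoRow (p r) (a r) (b r) (c t)

theorem dominoRow_left (p : ℕ) (a b : ℝ) : dominoRow p a b p = a := by
  simp [dominoRow]

theorem dominoRow_right (p : ℕ) (a b : ℝ) : dominoRow p a b (p + 1) = b := by
  simp [dominoRow]

theorem dominoRow_of_ne {p : ℕ} (a b : ℝ) {c : ℕ} (h : c ≠ p) (h' : c ≠ p + 1) :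
    dominoRow p a b c = 0 := by
  simp [dominoRow, h, h']

theorem dominoMinor_det_eliminate {N : ℕ} (p : Fin (N + 1) → ℕ) (a b : Fin (N + 1) → ℝ)
    (c : Fin (N + 1) → ℕ) (hc : StrictMono c) (hc0 : c 0 = p 0) (hp : ∀ s, p 0 ≤ p s)
    (ha : a 0 ≠ 0) :
    (dominoMinor p a b c).det = a 0 * (dominoMinor
      (fun s : Fin N => if p s.succ = p 0 then p 0 + 1 else p s.succ)
      (fun s => if p s.succ = p 0 then b s.succ - a s.succ * b 0 / a 0 else a s.succ)
      (fun s => if p s.succ = p 0 then 0 else b s.succ) (fun t => c t.succ)).det := by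
  set e : Fin (N + 1) → ℝ := fun r => if r ≠ 0 ∧ p r = p 0 then a r / a 0 else 0 with he
  set B : Matrix (Fin (N + 1)) (Fin (N + 1)) ℝ :=
    Matrix.of fun r t => dominoMinor p a b c r t - e r * dominoMinor p a b c 0 t with hB
  have he0 : e 0 = 0 := by simp [he]
  have hdet : (dominoMinor p a b c).det = B.det := by
    refine Matrix.det_eq_of_forall_row_eq_smul_add_const e 0 he0 fun r t => ?_
    simp [hB, he0]
  have hcol : ∀ r, B r 0 = if r = 0 then a 0 else 0 := by
    intro r
    by_cases hr : r = 0
    · subst hr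
      simp [hB, he0, dominoMinor, hc0, dominoRow_left]
    · by_cases hpr : p r = p 0
      · simp [hB, he, dominoMinor, hc0, hr, hpr, dominoRow_left, ha]
      · have := hp r
        rw [if_neg hr]
        simp only [hB, he, dominoMinor, Matrix.of_apply, hc0]
        rw [dominoRow_of_ne _ _ (by omega) (by omega)]
        simp [hpr]
  rw [hdet, Matrix.det_succ_column_zero, Finset.sum_eq_single 0]
  · simp only [hcol, if_true, Fin.val_zero, pow_zero, one_mul]
    congr 2
    ext s t
    have hlt : p 0 < c t.succ := hc0 ▸ hc (Fin.succ_pos t)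
    simp only [Matrix.submatrix_apply, Fin.succAbove_zero, hB, dominoMinor, Matrix.of_apply, he]
    by_cases hps : p s.succ = p 0
    · simp only [hps, if_true, ne_eq, Fin.succ_ne_zero, not_false_eq_true, true_and, dominoRow,
        hlt.ne', if_false]
      split_ifs <;> ring
    · simp [hps]
  · intro r _ hr
    simp [hcol, hr]
  · simp

theorem dominoMinor_det_of_right {N : ℕ} (p : Fin (N + 1) → ℕ) (a b : Fin (N + 1) → ℝ)
    (c : Fin (N + 1) → ℕ) (hc : StrictMono c) (hc0 : c 0 = p 0 + 1) :
    (dominoMinor p a b c).det = b 0 * (dominoMinor (fun s : Fin N => p s.succ)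
      (fun s => a s.succ) (fun s => b s.succ) (fun t => c t.succ)).det := by
  have hrow : ∀ t : Fin N, dominoMinor p a b c 0 t.succ = 0 := fun t => by
    have := hc (Fin.succ_pos t)
    exact dominoRow_of_ne _ _ (by omega) (by omega)
  have h0 : dominoMinor p a b c 0 0 = b 0 := by
    simp [dominoMinor, hc0, dominoRow_right]
  rw [Matrix.det_succ_row_zero, Finset.sum_eq_single 0]
  · simp only [h0, Fin.val_zero, pow_zero, one_mul]
    rfl
  · intro t _ ht
    obtain ⟨t, rfl⟩ := Fin.exists_succ_eq.2 ht
    simp [hrow]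
  · simp

/-- Minors of a matrix whose rows are nonnegative dominoes, sorted by position and then by
slope, are nonnegative; they are positive if the diagonal entries are positive and slopes
are strictly sorted where needed. -/
theorem dominoMinor_det_sorted {N : ℕ} : ∀ (p : Fin N → ℕ) (a b : Fin N → ℝ) (c : Fin N → ℕ),
    StrictMono c → Monotone p → (∀ r, 0 ≤ a r) → (∀ r, 0 ≤ b r) →
    (∀ r s, r < s → p r = p s → a s * b r ≤ a r * b s) →
    0 ≤ (dominoMinor p a b c).det ∧
    ((∀ r, (c r = p r ∧ 0 < a r) ∨ (c r = p r + 1 ∧ 0 < b r)) →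
      (∀ r s, r < s → p r = p s → c r = p r → c s = p s + 1 → a s * b r < a r * b s) →
      0 < (dominoMinor p a b c).det) := by
  induction N with
  | zero => intro p a b c _ _ _ _ _; simp
  | succ N ih =>
    intro p a b c hc hp ha hb hr
    have hp0 : ∀ s, p 0 ≤ p s := fun s => hp (Fin.zero_le s)
    have hc0 : ∀ t : Fin N, c 0 < c t.succ := fun t => hc (Fin.succ_pos t)
    have hc' : StrictMono fun t : Fin N => c t.succ := fun _ _ h => hc (Fin.succ_lt_succ_iff.2 h)
    have hp' : Monotone fun s : Fin N => p s.succ := fun _ _ h => hp (Fin.succ_le_succ_iff.2 h)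
    rcases lt_trichotomy (c 0) (p 0) with h | h | h
    · have hz : (dominoMinor p a b c).det = 0 := Matrix.det_eq_zero_of_column_eq_zero 0 fun r =>
        dominoRow_of_ne _ _ (by have := hp0 r; omega) (by have := hp0 r; omega)
      refine ⟨hz.ge, fun hd _ => ?_⟩
      rcases hd 0 with h' | h' <;> omega
    · rcases (ha 0).eq_or_lt with h0 | h0
      · have hz : (dominoMinor p a b c).det = 0 := by
          rcases (hb 0).eq_or_lt with h1 | h1
          · exact Matrix.det_eq_zero_of_row_eq_zero 0 fun t => by
              simp [dominoMinor, dominoRow, ← h0, ← h1]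
          · refine Matrix.det_eq_zero_of_column_eq_zero 0 fun s => ?_
            by_cases hs : p s = p 0
            · have : a s = 0 := by
                rcases Fin.eq_zero_or_eq_succ s with rfl | ⟨s, rfl⟩
                · exact h0.symm
                · have := hr 0 s.succ (Fin.succ_pos s) hs.symm
                  rw [← h0, zero_mul] at this
                  nlinarith [ha s.succ]
              simp [dominoMinor, h, ← hs, dominoRow_left, this]
            · have := hp0 s
              exact dominoRow_of_ne _ _ (by omega) (by omega)
        refine ⟨hz.ge, fun hd _ => ?_⟩
        rcases hd 0 with h' | h'
        · linarith [h'.2]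
        · omega
      · have hslope : ∀ s : Fin N, p s.succ = p 0 →
            0 ≤ b s.succ - a s.succ * b 0 / a 0 := fun s hs => by
          rw [sub_nonneg, div_le_iff₀ h0, mul_comm (b _)]
          exact hr 0 s.succ (Fin.succ_pos s) hs.symm
        rw [dominoMinor_det_eliminate p a b c hc h hp0 h0.ne']
        obtain ⟨h1, h2⟩ := ih
          (fun s : Fin N => if p s.succ = p 0 then p 0 + 1 else p s.succ)
          (fun s => if p s.succ = p 0 then b s.succ - a s.succ * b 0 / a 0 else a s.succ)
          (fun s => if p s.succ = p 0 then 0 else b s.succ) (fun t => c t.succ) hc'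
          (fun r s hrs => by
            have h3 := hp' hrs
            have h4 := hp0 r.succ
            have h5 := hp0 s.succ
            dsimp only at h3 ⊢
            split_ifs <;> omega)
          (fun s => by
            split_ifs with hs
            · exact hslope s hs
            · exact ha _)
          (fun s => by
            split_ifs
            · exact le_rfl
            · exact hb _)
          (fun r s hrs hps => by
            have h3 := hp' hrs.le
            have h4 := hp0 r.succ
            dsimp only at h3 hps ⊢
            by_cases hs : p s.succ = p 0
            · have : p r.succ = p 0 := by omega
              simp [hs, this]
            · by_cases hr0 : p r.succ = p 0
              · simp only [hr0, hs, if_true, if_false, mul_zero]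
                exact mul_nonneg (hslope r hr0) (hb _)
              · simp only [hr0, hs, if_false] at hps ⊢
                exact hr _ _ (Fin.succ_lt_succ_iff.2 hrs) hps)
        refine ⟨mul_nonneg h0.le h1, fun hd hst => mul_pos h0 (h2 ?_ ?_)⟩
        · intro s
          have h3 := hc0 s
          have h4 := hd s.succ
          by_cases hs : p s.succ = p 0
          · simp only [hs, if_true]
            have h5 : c s.succ = p 0 + 1 := by omega
            refine Or.inl ⟨h5, ?_⟩
            rw [sub_pos, div_lt_iff₀ h0, mul_comm (b _)]
            exact hst 0 s.succ (Fin.succ_pos s) hs.symm h (by omega)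
          · simpa only [hs, if_false] using h4
        · intro r s hrs hps hcr hcs
          have h3 := hd s.succ
          by_cases hs : p s.succ = p 0
          · simp only [hs, if_true] at hcs
            omega
          · simp only [hs, if_false] at hcs hps ⊢
            by_cases hr0 : p r.succ = p 0
            · simp only [hr0, if_true] at hcr ⊢
              rw [mul_zero]
              refine mul_pos ?_ ?_
              · rw [sub_pos, div_lt_iff₀ h0, mul_comm (b _)]
                exact hst 0 r.succ (Fin.succ_pos r) hr0.symm h (by omega)
              · rcases h3 with h3 | h3
                · omega
                · exact h3.2
            · simp only [hr0, if_false] at hcr hps ⊢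
              exact hst _ _ (Fin.succ_lt_succ_iff.2 hrs) hps hcr hcs
    · by_cases h' : c 0 = p 0 + 1
      · rw [dominoMinor_det_of_right p a b c hc h']
        obtain ⟨h1, h2⟩ := ih (fun s => p s.succ) (fun s => a s.succ) (fun s => b s.succ)
          (fun t => c t.succ) hc' hp' (fun _ => ha _) (fun _ => hb _)
          (fun r s h => hr _ _ (Fin.succ_lt_succ_iff.2 h))
        refine ⟨mul_nonneg (hb 0) h1, fun hd hst => mul_pos ?_ (h2 (fun _ => hd _)
          fun r s h => hst _ _ (Fin.succ_lt_succ_iff.2 h))⟩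
        rcases hd 0 with h3 | h3
        · omega
        · exact h3.2
      · have hz : (dominoMinor p a b c).det = 0 := Matrix.det_eq_zero_of_row_eq_zero 0 fun t => by
          have := hc.monotone (Fin.zero_le t)
          exact dominoRow_of_ne _ _ (by omega) (by omega)
        refine ⟨hz.ge, fun hd _ => ?_⟩
        rcases hd 0 with h' | h' <;> omega

/-- The sign of the permutation sorting `κ`, as a product over inversions. -/
def inversionSign {N : ℕ} {ι : Type*} [LinearOrder ι] (κ : Fin N → ι) : ℝ :=
  ∏ i, ∏ j, if i < j ∧ κ j < κ i then -1 else 1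

theorem strictMono_comp_sort {N : ℕ} {ι : Type*} [LinearOrder ι] {κ : Fin N → ι}
    (hκ : Function.Injective κ) : StrictMono (κ ∘ Tuple.sort κ) :=
  (Tuple.monotone_sort κ).strictMono_of_injective (hκ.comp (Equiv.injective _))

theorem inversionSign_eq_sign_sort {N : ℕ} {ι : Type*} [LinearOrder ι] {κ : Fin N → ι}
    (hκ : Function.Injective κ) :
    inversionSign κ = ((Equiv.Perm.sign (Tuple.sort κ) : ℤ) : ℝ) := by
  rw [← Equiv.Perm.sign_inv, Equiv.Perm.sign_eq_prod_prod_Ioi]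
  push_cast
  refine Finset.prod_congr rfl fun i _ => ?_
  have hsub : Finset.Ioi i = Finset.univ.filter (fun j => i < j) := by ext; simp
  rw [hsub, Finset.prod_filter]
  refine Finset.prod_congr rfl fun j _ => ?_
  have key : ∀ x y, (Tuple.sort κ)⁻¹ x < (Tuple.sort κ)⁻¹ y ↔ κ x < κ y := fun x y => by
    rw [← (strictMono_comp_sort hκ).lt_iff_lt]
    simp
  by_cases hij : i < j
  · have hne : κ i ≠ κ j := fun h => hij.ne (hκ h)
    rcases hne.lt_or_gt with h | h
    · simp only [key, hij, h, h.not_gt, and_false, if_true, if_false]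
      norm_num
    · simp only [key, hij, h, h.not_gt, and_self, if_true, if_false]
      norm_num
  · simp [hij]

/-- Dominoes are compared first by position, then by slope. -/
def dominoKey (p : ℕ) (a b : ℝ) : ℕ ×ₗ ℝ := toLex (p, b / a)

theorem dominoKey_lt_iff {p q : ℕ} {a b a' b' : ℝ} :
    dominoKey p a b < dominoKey q a' b' ↔ p < q ∨ p = q ∧ b / a < b' / a' := by
  simp [dominoKey, Prod.Lex.toLex_lt_toLex]

theorem dominoKey_eq_iff {p q : ℕ} {a b a' b' : ℝ} :
    dominoKey p a b = dominoKey q a' b' ↔ p = q ∧ b / a = b' / a' := by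
  simp [dominoKey]

section Sorting

variable {N : ℕ} (p : Fin N → ℕ) (a b : Fin N → ℝ) (c : Fin N → ℕ)

theorem dominoMinor_det_eq_zero_of_not_injective (ha : ∀ r, 0 < a r)
    (h : ¬ Function.Injective fun r => dominoKey (p r) (a r) (b r)) :
    (dominoMinor p a b c).det = 0 := by
  simp only [Function.Injective, not_forall] at h
  obtain ⟨r, s, hrs, hne⟩ := h
  obtain ⟨hp, hab⟩ := dominoKey_eq_iff.1 hrs
  have hb : b r = a r / a s * b s := by
    have := (ha r).ne'
    have := (ha s).ne'
    field_simp at hab ⊢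
    linarith
  have hrow : ∀ t, dominoMinor p a b c r t = (a r / a s) * dominoMinor p a b c s t := fun t => by
    have : a r = a r / a s * a s := by rw [div_mul_cancel₀ _ (ha s).ne']
    simp only [dominoMinor, Matrix.of_apply, dominoRow, hp, hb]
    split_ifs <;> linarith
  have : (dominoMinor p a b c) = (dominoMinor p a b c).updateRow r
      ((a r / a s) • dominoMinor p a b c s) := by
    ext x t
    by_cases hx : x = r
    · subst hx; simp [hrow]
    · simp [hx]
  rw [this, Matrix.det_updateRow_smul, Matrix.det_updateRow_eq_zero (Ne.symm hne), mul_zero]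

theorem inversionSign_mul_dominoMinor_det
    (h : Function.Injective fun r => dominoKey (p r) (a r) (b r)) :
    inversionSign (fun r => dominoKey (p r) (a r) (b r)) * (dominoMinor p a b c).det =
      (dominoMinor (p ∘ Tuple.sort fun r => dominoKey (p r) (a r) (b r))
        (a ∘ Tuple.sort fun r => dominoKey (p r) (a r) (b r))
        (b ∘ Tuple.sort fun r => dominoKey (p r) (a r) (b r)) c).det := by
  rw [inversionSign_eq_sign_sort h]
  exact (Matrix.det_permute _ (dominoMinor p a b c)).symm

theorem inversionSign_mul_dominoMinor_det_nonneg
    (h : Function.Injective fun r => dominoKey (p r) (a r) (b r)) (ha : ∀ r, 0 < a r)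
    (hb : ∀ r, 0 ≤ b r) (hc : StrictMono c) :
    0 ≤ inversionSign (fun r => dominoKey (p r) (a r) (b r)) * (dominoMinor p a b c).det ∧
    ((∀ r, let s := Tuple.sort (fun r => dominoKey (p r) (a r) (b r)) r
        c r = p s ∨ (c r = p s + 1 ∧ 0 < b s)) →
      0 < inversionSign (fun r => dominoKey (p r) (a r) (b r)) * (dominoMinor p a b c).det) := by
  rw [inversionSign_mul_dominoMinor_det p a b c h]
  have hmono := strictMono_comp_sort h
  set σ := Tuple.sort fun r => dominoKey (p r) (a r) (b r)
  have hlt : ∀ r s, r < s → p (σ r) < p (σ s) ∨ p (σ r) = p (σ s) ∧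
      a (σ s) * b (σ r) < a (σ r) * b (σ s) := fun r s hrs => by
    rcases dominoKey_lt_iff.1 (hmono hrs) with h | ⟨h, h'⟩
    · exact Or.inl h
    · rw [div_lt_div_iff₀ (ha _) (ha _)] at h'
      exact Or.inr ⟨h, by linarith⟩
  have hp : Monotone (p ∘ σ) := fun r s hrs => by
    rcases hrs.eq_or_lt with rfl | hrs
    · exact le_rfl
    · rcases hlt r s hrs with h | h
      · exact h.le
      · exact h.1.le
  obtain ⟨h1, h2⟩ := dominoMinor_det_sorted (p ∘ σ) (a ∘ σ) (b ∘ σ) c hc hp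
    (fun r => (ha _).le) (fun r => hb _) (fun r s hrs hps => by
      rcases hlt r s hrs with h | h
      · exact absurd hps h.ne
      · exact h.2.le)
  refine ⟨h1, fun hd => h2 (fun r => ?_) fun r s hrs hps _ _ => ?_⟩
  · rcases hd r with h | h
    · exact Or.inl ⟨h, ha _⟩
    · exact Or.inr h
  · rcases hlt r s hrs with h | h
    · exact absurd hps h.ne
    · exact h.2

/-- If the dominoes admit a system of distinct representatives among their nonzero columns,
then the minor on the sorted representatives has the sign of the sorting permutation. -/
theorem exists_inversionSign_mul_dominoMinor_det_pos
    (h : Function.Injective fun r => dominoKey (p r) (a r) (b r)) (ha : ∀ r, 0 < a r)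
    (hb : ∀ r, 0 ≤ b r) (g : Fin N → ℕ) (hg : Function.Injective g)
    (hgp : ∀ r, g r = p r ∨ (g r = p r + 1 ∧ 0 < b r)) :
    ∃ c : Fin N → ℕ, StrictMono c ∧ (∀ t, ∃ r, c t = g r) ∧
      0 < inversionSign (fun r => dominoKey (p r) (a r) (b r)) * (dominoMinor p a b c).det := by
  set I := Finset.univ.image g with hI
  have hcard : I.card = N := by rw [hI, Finset.card_image_of_injective _ hg]; simp
  set c := I.orderEmbOfFin hcard with hcdef
  have hc : StrictMono c := (I.orderEmbOfFin hcard).strictMono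
  refine ⟨c, hc, fun t => ?_, (inversionSign_mul_dominoMinor_det_nonneg p a b c h ha hb hc).2 ?_⟩
  · have := I.orderEmbOfFin_mem hcard t
    simp only [hI, Finset.mem_image, Finset.mem_univ, true_and] at this
    obtain ⟨r, hr⟩ := this
    exact ⟨r, hr.symm⟩
  have hmono := strictMono_comp_sort h
  set σ := Tuple.sort fun r => dominoKey (p r) (a r) (b r)
  have hlt : ∀ r s, r < s → p (σ r) < p (σ s) ∨ p (σ r) = p (σ s) ∧
      b (σ r) / a (σ r) < b (σ s) / a (σ s) := fun r s hrs =>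
    dominoKey_lt_iff.1 (hmono hrs)
  have hcsurj : ∀ s, ∃ t, c t = g (σ s) := fun s => by
    have : g (σ s) ∈ Set.range c := by
      rw [hcdef, Finset.range_orderEmbOfFin]
      simp [hI]
    exact this
  choose τ hτ using hcsurj
  have hτinj : Function.Injective τ := fun x y hxy =>
    σ.injective (hg (by rw [← hτ, ← hτ, hxy]))
  have hle : ∀ r m, (∀ s ≤ r, g (σ s) ≤ m) → c r ≤ m := fun r m hm => by
    by_contra! hcm
    have hmaps : ∀ s ∈ Finset.Iic r, τ s ∈ Finset.Iio r := fun s hs => by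
      rw [Finset.mem_Iio, ← hc.lt_iff_lt, hτ]
      exact (hm s (Finset.mem_Iic.1 hs)).trans_lt hcm
    have := Finset.card_le_card_of_injOn τ hmaps hτinj.injOn
    simp at this
  have hge : ∀ r m, (∀ s, r ≤ s → m ≤ g (σ s)) → m ≤ c r := fun r m hm => by
    by_contra! hcm
    have hmaps : ∀ s ∈ Finset.Ici r, τ s ∈ Finset.Ioi r := fun s hs => by
      rw [Finset.mem_Ioi, ← hc.lt_iff_lt, hτ]
      exact hcm.trans_le (hm s (Finset.mem_Ici.1 hs))
    have := Finset.card_le_card_of_injOn τ hmaps hτinj.injOn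
    simp at this
    omega
  intro r
  dsimp only
  have h1 : p (σ r) ≤ c r := hge r _ fun s hs => by
    have : p (σ r) ≤ p (σ s) := by
      rcases hs.eq_or_lt with rfl | hs
      · exact le_rfl
      · rcases hlt r s hs with h | h <;> omega
    rcases hgp (σ s) with h | h <;> omega
  by_cases hb0 : 0 < b (σ r)
  · have h2 : c r ≤ p (σ r) + 1 := hle r _ fun s hs => by
      have : p (σ s) ≤ p (σ r) := by
        rcases hs.eq_or_lt with rfl | hs
        · exact le_rfl
        · rcases hlt s r hs with h | h <;> omega
      rcases hgp (σ s) with h | h <;> omega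
    rcases h1.eq_or_lt with h | h
    · exact Or.inl h.symm
    · exact Or.inr ⟨by omega, hb0⟩
  · refine Or.inl (le_antisymm (hle r _ fun s hs => ?_) h1)
    have hb1 : b (σ r) = 0 := le_antisymm (not_lt.1 hb0) (hb _)
    rcases hs.eq_or_lt with rfl | hs
    · rcases hgp (σ s) with h | h
      · exact h.le
      · exact absurd h.2 hb0
    · rcases hlt s r hs with h | h
      · rcases hgp (σ s) with h' | h' <;> omega
      · have h3 := h.2
        rw [hb1, zero_div] at h3
        exact absurd h3 (not_lt.2 (div_nonneg (hb _) (ha _).le))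

end Sorting

namespace ChordDiagram

variable {n k : ℕ} (D : ChordDiagram n k)

section Combinatorics

variable {D} {l m p : Fin k}

theorem tail_lt_tail_iff : D.tail l < D.tail m ↔ l < m := D.tail_strictMono.lt_iff_lt

theorem tail_lt_head (l : Fin k) : D.tail l < D.head l := by
  have := D.tail_add_two_le_head l
  omega

theorem head_lt (l : Fin k) : D.head l < n := by
  have := D.head_add_two_le l
  omega

theorem tail_lt (l : Fin k) : D.tail l < n := (tail_lt_head l).trans (head_lt l)

theorem Descendant.lt (h : D.Descendant l m) : l < m := tail_lt_tail_iff.1 h.1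

theorem descendant_iff_of_lt (h : l < m) : D.Descendant l m ↔ D.tail m < D.head l :=
  ⟨fun hd => (tail_lt_head m).trans_le hd.2, fun ht => ⟨tail_lt_tail_iff.2 h, by
    have := D.noncrossing l m h
    omega⟩⟩

theorem Descendant.of_between (h : D.Descendant p m) (hp : p < l) (hl : l < m) :
    D.Descendant p l :=
  (descendant_iff_of_lt hp).2 ((tail_lt_tail_iff.2 hl).trans
    ((descendant_iff_of_lt h.lt).1 h))

theorem Descendant.trans (h : D.Descendant l p) (h' : D.Descendant p m) : D.Descendant l m :=
  ⟨h.1.trans h'.1, h'.2.trans h.2⟩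

theorem not_descendant_self : ¬ D.Descendant l l := fun h => h.lt.false

theorem IsParent.unique {q : Fin k} (h : D.IsParent p m) (h' : D.IsParent q m) : p = q :=
  D.tail_strictMono.injective (le_antisymm (h'.2 p h.1) (h.2 q h'.1))

theorem IsParent.lt (h : D.IsParent p m) : p < m := h.1.lt

theorem IsParent.le_of_descendant (h : D.IsParent p m) (hl : D.Descendant l m) : l ≤ p :=
  D.tail_strictMono.le_iff_le.1 (h.2 l hl)

theorem exists_isParent (h : ¬ D.IsTop l) : ∃ m, D.IsParent m l := by
  simp only [IsTop, not_forall, not_not] at h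
  obtain ⟨m, hm⟩ := h
  obtain ⟨p, hp, hmax⟩ := Finset.exists_max_image
    (Finset.univ.filter fun m => D.Descendant m l) D.tail ⟨m, by simpa using hm⟩
  simp only [Finset.mem_filter, Finset.mem_univ, true_and] at hp hmax
  exact ⟨p, hp, hmax⟩

variable (D) in
/-- The parent of a non-top chord (and the chord itself for a top chord). -/
def parent (l : Fin k) : Fin k := if h : ∃ m, D.IsParent m l then h.choose else l

theorem isParent_parent (h : ¬ D.IsTop l) : D.IsParent (D.parent l) l := by
  have := exists_isParent h
  rw [parent, dif_pos this]
  exact this.choose_spec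

theorem IsParent.not_isTop (h : D.IsParent p m) : ¬ D.IsTop m := fun ht => ht p h.1

theorem isParent_iff : D.IsParent p m ↔ ¬ D.IsTop m ∧ p = D.parent m :=
  ⟨fun h => ⟨h.not_isTop, h.unique (isParent_parent h.not_isTop)⟩,
    fun h => h.2 ▸ isParent_parent h.1⟩

end Combinatorics

/-- The position of the three dominoes of the `l`-th row of a domino matrix: at the tail of the
chord, at its head, and at the tail of its parent (or the last marker for a top chord). -/
def piecePos (l : Fin k) : Fin 3 → ℕ :=
  ![D.tail l, D.head l, if D.IsTop l then n else D.tail (D.parent l)]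

/-- The absolute value of the left entry of the dominoes of the `l`-th row. -/
def pieceLeft (α γ ε : Fin k → ℝ) (l : Fin k) : Fin 3 → ℝ :=
  ![α l, |γ l|, if D.IsTop l then |ε l| else |ε l| * α (D.parent l)]

/-- The absolute value of the right entry of the dominoes of the `l`-th row. -/
def pieceRight (β δ ε : Fin k → ℝ) (l : Fin k) : Fin 3 → ℝ :=
  ![β l, |δ l|, if D.IsTop l then 0 else |ε l| * β (D.parent l)]

/-- The sign of the dominoes of the `l`-th row. -/
def pieceSign (l : Fin k) : Fin 3 → ℝ :=
  ![1, (-1) ^ D.below l,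
    if D.IsTop l then (-1) ^ D.behind l else (-1) ^ D.beyond l (D.parent l)]

/-- The chords that are counted in the sign of a domino of the `l`-th row. -/
def PieceFlip (l : Fin k) : Fin 3 → Fin k → Prop :=
  ![fun _ => False, D.Descendant l, fun m =>
    if D.IsTop l then D.tail l < D.tail m else
      D.Descendant (D.parent l) m ∧ D.tail m < D.tail l]

theorem pieceSign_eq_prod (l : Fin k) (t : Fin 3) :
    D.pieceSign l t = ∏ m, if D.PieceFlip l t m then -1 else 1 := by
  rw [Finset.prod_ite, Finset.prod_const, Finset.prod_const_one, mul_one]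
  fin_cases t
  · simp [pieceSign, PieceFlip]
  · simp [pieceSign, PieceFlip, below]
  · by_cases h : D.IsTop l <;> simp [pieceSign, PieceFlip, behind, beyond, h]

section Variables

variable {α β γ δ ε : Fin k → ℝ}

theorem abs_eq_of_neg_one_pow {x : ℝ} {e : ℕ} (h : 0 < (-1 : ℝ) ^ e * x) :
    (-1 : ℝ) ^ e * |x| = x := by
  rcases neg_one_pow_eq_or ℝ e with he | he <;> rw [he] at h ⊢
  · rw [abs_of_pos (by linarith)]; ring
  · rw [abs_of_neg (by linarith)]; ring

variable {D}

theorem SignRules.ne_zero (hs : D.SignRules α β γ δ ε) (l : Fin k) :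
    γ l ≠ 0 ∧ δ l ≠ 0 ∧ ε l ≠ 0 := by
  obtain ⟨-, -, hγ, hδ, hε, hε', -, -⟩ := hs
  refine ⟨right_ne_zero_of_mul (hγ l).ne', right_ne_zero_of_mul (hδ l).ne', ?_⟩
  by_cases h : D.IsTop l
  · exact right_ne_zero_of_mul (hε l h).ne'
  · exact right_ne_zero_of_mul (hε' l _ (isParent_parent h)).ne'

theorem SignRules.pieceLeft_pos (hs : D.SignRules α β γ δ ε) (l : Fin k) (t : Fin 3) :
    0 < D.pieceLeft α γ ε l t := by
  obtain ⟨h1, h2, h3⟩ := hs.ne_zero l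
  have hα := hs.1
  fin_cases t
  · exact hα l
  · simpa [pieceLeft] using h1
  · simp only [pieceLeft, Fin.reduceFinMk, Matrix.cons_val]
    split_ifs
    · positivity
    · exact mul_pos (abs_pos.2 h3) (hα _)

theorem SignRules.pieceRight_pos (hs : D.SignRules α β γ δ ε) (l : Fin k) (t : Fin 3)
    (ht : t = 2 → ¬ D.IsTop l) : 0 < D.pieceRight β δ ε l t := by
  obtain ⟨h1, h2, h3⟩ := hs.ne_zero l
  have hβ := hs.2.1
  fin_cases t
  · exact hβ l
  · simpa [pieceRight] using h2
  · simp only [pieceRight, Fin.reduceFinMk, Matrix.cons_val, ht rfl, if_false]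
    exact mul_pos (abs_pos.2 h3) (hβ _)

theorem SignRules.pieceRight_nonneg (hs : D.SignRules α β γ δ ε) (l : Fin k) (t : Fin 3) :
    0 ≤ D.pieceRight β δ ε l t := by
  by_cases ht : t = 2 ∧ D.IsTop l
  · obtain ⟨rfl, h⟩ := ht
    simp [pieceRight, h]
  · exact (hs.pieceRight_pos l t (by tauto)).le

theorem SignRules.dominoMatrix_apply (hs : D.SignRules α β γ δ ε) (l : Fin k) (a : Fin n) :
    D.dominoMatrix α β γ δ ε l a = ∑ t, D.pieceSign l t *
      dominoRow (D.piecePos l t) (D.pieceLeft α γ ε l t) (D.pieceRight β δ ε l t) (a + 1) := by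
  obtain ⟨-, -, hγ, hδ, hε, hε', -, -⟩ := hs
  have e1 := abs_eq_of_neg_one_pow (hγ l)
  have e2 := abs_eq_of_neg_one_pow (hδ l)
  have ha := a.2
  have hH : ∀ x : ℕ, (-1 : ℝ) ^ D.below l * dominoRow (D.head l) |γ l| |δ l| x =
      (if x = D.head l then γ l else 0) + (if x = D.head l + 1 then δ l else 0) := fun x => by
    simp only [dominoRow, mul_add, mul_ite, mul_zero, e1, e2]
  rw [Fin.sum_univ_three]
  by_cases h : D.IsTop l
  · have hp : ∀ m, ¬ D.IsParent m l := fun m hm => hm.not_isTop h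
    have e3 := abs_eq_of_neg_one_pow (hε l h)
    have hE : (-1 : ℝ) ^ D.behind l * dominoRow n |ε l| 0 (a + 1) =
        if (a : ℕ) + 1 = n then ε l else 0 := by
      simp only [dominoRow, mul_ite, mul_zero, e3, ite_self, add_zero]
    simp only [dominoMatrix, pieceSign, piecePos, pieceLeft, pieceRight, Matrix.cons_val, h,
      if_true, hp, if_false, Finset.sum_const_zero, add_zero, Matrix.of_apply, true_and, hH, hE,
      one_mul]
    simp only [dominoRow]
    ring
  · have e3 := abs_eq_of_neg_one_pow (hε' l _ (isParent_parent h))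
    have hE : (-1 : ℝ) ^ D.beyond l (D.parent l) * dominoRow (D.tail (D.parent l))
        (|ε l| * α (D.parent l)) (|ε l| * β (D.parent l)) (a + 1) =
        (if (a : ℕ) + 1 = D.tail (D.parent l) then ε l * α (D.parent l) else 0) +
        (if (a : ℕ) + 1 = D.tail (D.parent l) + 1 then ε l * β (D.parent l) else 0) := by
      simp only [dominoRow, mul_add, mul_ite, mul_zero, ← mul_assoc, e3]
    simp only [dominoMatrix, pieceSign, piecePos, pieceLeft, pieceRight, Matrix.cons_val, h,
      if_false, Matrix.of_apply, false_and, hH, hE, one_mul, isParent_iff, not_false_eq_true,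
      true_and, Finset.sum_ite_eq', Finset.mem_univ, if_true]
    simp only [dominoRow]
    ring

theorem SignRules.slope_lt_of_descendant (hs : D.SignRules α β γ δ ε) {l : Fin k} :
    ∀ m, D.Descendant l m → D.head m = D.head l → δ m / γ m < δ l / γ l := by
  have hc := hs.2.2.2.2.2.2.1
  intro m
  induction m using WellFoundedLT.induction with
  | ind m ih =>
    intro hd hh
    have hpar := isParent_parent (fun ht : D.IsTop m => ht l hd)
    set p := D.parent m
    have h2 := hpar.1.2
    rcases (hpar.le_of_descendant hd).eq_or_lt with hp | hp
    · exact hp ▸ hc m p hpar (by rw [hh, hp])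
    · have h3 := hd.of_between hp hpar.lt
      have h4 := h3.2
      exact (hc m p hpar (by omega)).trans (ih p hpar.lt h3 (by omega))

theorem SignRules.abs_slope (hs : D.SignRules α β γ δ ε) (l : Fin k) :
    |δ l| / |γ l| = δ l / γ l := by
  have e1 := abs_eq_of_neg_one_pow (hs.2.2.1 l)
  have e2 := abs_eq_of_neg_one_pow (hs.2.2.2.1 l)
  rw [← e1, ← e2, mul_div_mul_left _ _ (by positivity)]
  simp [abs_mul]

variable (D α β γ δ ε) in
/-- The sorting key of the dominoes of the `l`-th row. -/
def pieceKey (l : Fin k) (t : Fin 3) : ℕ ×ₗ ℝ :=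
  dominoKey (D.piecePos l t) (D.pieceLeft α γ ε l t) (D.pieceRight β δ ε l t)

theorem pieceKey_zero (l : Fin k) :
    D.pieceKey α β γ δ ε l 0 = dominoKey (D.tail l) (α l) (β l) := rfl

theorem SignRules.pieceKey_one (hs : D.SignRules α β γ δ ε) (l : Fin k) :
    D.pieceKey α β γ δ ε l 1 = toLex (D.head l, δ l / γ l) := by
  rw [← hs.abs_slope]; rfl

theorem pieceKey_two_of_isTop {l : Fin k} (h : D.IsTop l) :
    D.pieceKey α β γ δ ε l 2 = toLex (n, 0) := by
  simp [pieceKey, dominoKey, piecePos, pieceLeft, pieceRight, h]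

theorem SignRules.pieceKey_two_of_not_isTop (hs : D.SignRules α β γ δ ε) {l : Fin k}
    (h : ¬ D.IsTop l) : D.pieceKey α β γ δ ε l 2 = D.pieceKey α β γ δ ε (D.parent l) 0 := by
  have := (hs.ne_zero l).2.2
  simp only [pieceKey, dominoKey, piecePos, pieceLeft, pieceRight, h, Matrix.cons_val, if_false]
  rw [mul_div_mul_left _ _ (abs_ne_zero.2 this)]

theorem pieceKey_zero_lt_iff {l m : Fin k} :
    D.pieceKey α β γ δ ε l 0 < D.pieceKey α β γ δ ε m 0 ↔ l < m := by
  rw [pieceKey_zero, pieceKey_zero, dominoKey_lt_iff, tail_lt_tail_iff]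
  refine ⟨?_, Or.inl⟩
  rintro (h | ⟨h, h'⟩)
  · exact h
  · rw [D.tail_strictMono.injective h] at h'
    exact absurd h' (lt_irrefl _)

theorem SignRules.pieceKey_zero_lt_one_iff (hs : D.SignRules α β γ δ ε) {l m : Fin k} :
    D.pieceKey α β γ δ ε m 0 < D.pieceKey α β γ δ ε l 1 ↔ D.tail m < D.head l := by
  rw [pieceKey_zero, hs.pieceKey_one, dominoKey, Prod.Lex.toLex_lt_toLex]
  refine ⟨?_, Or.inl⟩
  rintro (h | ⟨h, h'⟩)
  · exact h
  · exact absurd h' (hs.2.2.2.2.2.2.2 m l h.symm).not_gt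

theorem SignRules.pieceKey_one_lt_zero_iff (hs : D.SignRules α β γ δ ε) {l m : Fin k} :
    D.pieceKey α β γ δ ε l 1 < D.pieceKey α β γ δ ε m 0 ↔ D.head l ≤ D.tail m := by
  rw [pieceKey_zero, hs.pieceKey_one, dominoKey, Prod.Lex.toLex_lt_toLex, le_iff_lt_or_eq]
  refine or_congr_right ⟨And.left, fun h => ⟨h, hs.2.2.2.2.2.2.2 m l h⟩⟩

theorem SignRules.pieceKey_one_lt_one_iff (hs : D.SignRules α β γ δ ε) {l m : Fin k}
    (hlm : l < m) : D.pieceKey α β γ δ ε m 1 < D.pieceKey α β γ δ ε l 1 ↔ D.Descendant l m := by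
  rw [hs.pieceKey_one, hs.pieceKey_one, Prod.Lex.toLex_lt_toLex]
  refine ⟨?_, fun h => ?_⟩
  · rw [descendant_iff_of_lt hlm]
    have := tail_lt_head (D := D) m
    rintro (h | h)
    · simp only at h; omega
    · have := h.1
      simp only at this; omega
  · rcases h.2.eq_or_lt with h' | h'
    · exact Or.inr ⟨h', hs.slope_lt_of_descendant m h h'⟩
    · exact Or.inl h'

theorem SignRules.pieceKey_lt_of_isTop (hs : D.SignRules α β γ δ ε) {l m : Fin k}
    (h : D.IsTop l) {t : Fin 3} (ht : t = 2 → ¬ D.IsTop m) :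
    D.pieceKey α β γ δ ε m t < D.pieceKey α β γ δ ε l 2 := by
  rw [pieceKey_two_of_isTop h]
  have hT : ∀ m, D.pieceKey α β γ δ ε m 0 < toLex (n, 0) := fun m => by
    rw [pieceKey_zero, dominoKey, Prod.Lex.toLex_lt_toLex]
    exact Or.inl (tail_lt m)
  fin_cases t
  · exact hT m
  · simp only [Fin.mk_one, hs.pieceKey_one, Prod.Lex.toLex_lt_toLex]
    exact Or.inl (head_lt m)
  · simp only [Fin.reduceFinMk, hs.pieceKey_two_of_not_isTop (ht rfl)]
    exact hT _

theorem SignRules.pieceKey_lt_iff (hs : D.SignRules α β γ δ ε) {l m : Fin k} (hlm : l < m)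
    {s t : Fin 3} (hne : D.pieceKey α β γ δ ε l s ≠ D.pieceKey α β γ δ ε m t) :
    D.pieceKey α β γ δ ε m t < D.pieceKey α β γ δ ε l s ↔
      Xor (D.PieceFlip l s m) (D.PieceFlip m t l) := by
  have hml : ¬ D.Descendant m l := fun h => h.lt.not_gt hlm
  have htail : D.tail l < D.tail m := tail_lt_tail_iff.2 hlm
  have hflip0 : ∀ l m, D.PieceFlip l 0 m ↔ False := fun _ _ => Iff.rfl
  have hflip1 : ∀ l m, D.PieceFlip l 1 m ↔ D.Descendant l m := fun _ _ => Iff.rfl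
  have hflip2 : D.PieceFlip l 2 m ↔ D.IsTop l := by
    simp only [PieceFlip, Matrix.cons_val]
    split_ifs with h
    · simp [h, htail]
    · simp [h, htail.le]
  have hflip2' : D.PieceFlip m 2 l ↔ ¬ D.IsTop m ∧ D.Descendant (D.parent m) l := by
    simp only [PieceFlip, Matrix.cons_val]
    split_ifs with h
    · simp [h, htail.le]
    · simp [h, htail]
  have hm2 : ¬ D.IsTop m → (D.Descendant (D.parent m) l ↔ D.parent m < l) := fun h =>
    ⟨Descendant.lt, fun hp => (isParent_parent h).1.of_between hp hlm⟩
  have hanti : ∀ {x y : ℕ ×ₗ ℝ}, x < y → (y < x ↔ False) := fun h => iff_false_intro h.not_gt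
  have hxor : ∀ P, Xor P False ↔ P := fun P => by simp [Xor]
  have hxor' : ∀ P, Xor False P ↔ P := fun P => by simp [Xor]
  fin_cases s <;> fin_cases t <;> simp only [Fin.zero_eta, Fin.mk_one, Fin.reduceFinMk] at *
  · rw [hflip0, hflip0, hanti (pieceKey_zero_lt_iff.2 hlm)]; simp
  · rw [hflip0, hflip1, hs.pieceKey_one_lt_zero_iff]
    have := tail_lt_head (D := D) m
    simp only [hml, _root_.xor_self, iff_false]
    omega
  · rw [hflip0, hflip2']
    by_cases h : D.IsTop m
    · rw [hanti (hs.pieceKey_lt_of_isTop h (by simp))]; simp [h]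
    · rw [hs.pieceKey_two_of_not_isTop h, pieceKey_zero_lt_iff, hm2 h]; simp [h]
  · rw [hflip0, hflip1, hs.pieceKey_zero_lt_one_iff, descendant_iff_of_lt hlm, hxor]
  · rw [hflip1, hflip1, hs.pieceKey_one_lt_one_iff hlm]; simp [hml, hxor]
  · rw [hflip1, hflip2']
    by_cases h : D.IsTop m
    · rw [hanti (hs.pieceKey_lt_of_isTop h (by simp))]; simp [h, h l]
    · rw [hs.pieceKey_two_of_not_isTop h, hs.pieceKey_zero_lt_one_iff, hm2 h]
      have hpar := isParent_parent h
      set p := D.parent m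
      rcases lt_trichotomy p l with hp | rfl | hp
      · have h1 : ¬ D.Descendant l m := fun hd => (hpar.le_of_descendant hd).not_gt hp
        have h2 := (tail_lt_tail_iff.2 hp).trans (tail_lt_head (D := D) l)
        simp [h1, h2, hp, h]
      · simp [hpar.1, tail_lt_head]
      · have h1 : D.Descendant l m ↔ D.tail p < D.head l := by
          rw [← descendant_iff_of_lt hp]
          exact ⟨fun hd => hd.of_between hp hpar.lt, fun hd => hd.trans hpar.1⟩
        simp [h1, hp.not_gt, hxor]
  · rw [hflip0, hflip2]
    by_cases h : D.IsTop l
    · simp [h, hs.pieceKey_lt_of_isTop h]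
    · rw [hs.pieceKey_two_of_not_isTop h, pieceKey_zero_lt_iff]
      simp [h, ((isParent_parent h).lt.trans hlm).le]
  · rw [hflip1, hflip2]
    by_cases h : D.IsTop l
    · simp [h, hs.pieceKey_lt_of_isTop h, hml]
    · rw [hs.pieceKey_two_of_not_isTop h, hs.pieceKey_one_lt_zero_iff]
      have := tail_lt_tail_iff (D := D).2 ((isParent_parent h).lt.trans hlm)
      have := tail_lt_head (D := D) m
      simp only [h, hml, _root_.xor_self, iff_false]
      omega
  · rw [hflip2, hflip2']
    by_cases h : D.IsTop l
    · by_cases h' : D.IsTop m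
      · rw [pieceKey_two_of_isTop h, pieceKey_two_of_isTop h'] at hne
        exact absurd rfl hne
      · simp [h, h', hs.pieceKey_lt_of_isTop h, h _]
    · by_cases h' : D.IsTop m
      · rw [hanti (hs.pieceKey_lt_of_isTop h' (by simp [h]))]
        simp [h, h']
      · rw [hs.pieceKey_two_of_not_isTop h, hs.pieceKey_two_of_not_isTop h'] at hne ⊢
        rw [pieceKey_zero_lt_iff]
        have hl := isParent_parent h
        simp only [h, h', not_false_eq_true, true_and, hxor']
        refine ⟨fun hp => (hm2 h').2 (hp.trans hl.lt), fun hd => ?_⟩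
        exact (hl.le_of_descendant hd).lt_of_ne fun he => hne (by rw [he])

end Variables

end ChordDiagram

theorem prod_prod_eq_prod_prod_ite_lt {N : ℕ} (F : Fin N → Fin N → ℝ) (hF : ∀ i, F i i = 1) :
    ∏ i, ∏ j, F i j = ∏ i, ∏ j, if i < j then F i j * F j i else 1 := by
  have h1 : ∀ i j, F i j = (if i < j then F i j else 1) * (if j < i then F i j else 1) :=
    fun i j => by
      rcases lt_trichotomy i j with h | rfl | h
      · simp [h, h.not_gt]
      · simp [hF]
      · simp [h, h.not_gt]
  have h2 : ∀ i j, (if i < j then F i j * F j i else 1) =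
      (if i < j then F i j else 1) * (if i < j then F j i else 1) :=
    fun i j => by split_ifs <;> simp
  simp_rw [h2, Finset.prod_mul_distrib]
  conv_lhs => enter [2, i, 2, j]; rw [h1]
  simp_rw [Finset.prod_mul_distrib]
  congr 1
  exact Finset.prod_comm

namespace ChordDiagram

variable {n k : ℕ} {D : ChordDiagram n k} {α β γ δ ε : Fin k → ℝ}

/-- The product of the signs of a choice of one domino in each row is the sign of the
permutation sorting the chosen dominoes. -/
theorem SignRules.prod_pieceSign (hs : D.SignRules α β γ δ ε) (σ : Fin k → Fin 3)
    (hinj : Function.Injective fun l => D.pieceKey α β γ δ ε l (σ l)) :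
    ∏ l, D.pieceSign l (σ l) = inversionSign fun l => D.pieceKey α β γ δ ε l (σ l) := by
  have hself : ∀ l t, ¬ D.PieceFlip l t l := fun l t => by
    fin_cases t
    · exact id
    · exact not_descendant_self
    · by_cases h : D.IsTop l <;> simp [PieceFlip, h]
  simp_rw [pieceSign_eq_prod]
  rw [prod_prod_eq_prod_prod_ite_lt _ fun l => if_neg (hself l _), inversionSign]
  refine Finset.prod_congr rfl fun l _ => Finset.prod_congr rfl fun m _ => ?_
  by_cases hlm : l < m
  · have h := hs.pieceKey_lt_iff hlm fun he => hlm.ne (hinj he)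
    simp only [hlm, if_true, true_and, h]
    by_cases h1 : D.PieceFlip l (σ l) m <;> by_cases h2 : D.PieceFlip m (σ m) l <;>
      simp [h1, h2]
  · simp [hlm]

end ChordDiagram

namespace Matrix

variable {N n : ℕ}

theorem det_mul_eq_sum_prod_mul_det (M : Matrix (Fin N) (Fin n) ℝ) (Z : Matrix (Fin n) (Fin N) ℝ) :
    (M * Z).det = ∑ r : Fin N → Fin n, (∏ i, M i (r i)) * (Z.submatrix r id).det := by
  have h : M * Z = fun i => ∑ j, M i j • Z j := by
    ext i t
    simp [Matrix.mul_apply, Finset.sum_apply]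
  have h2 := (detRowAlternating (R := ℝ) (n := Fin N)).toMultilinearMap.map_sum
    (fun i j => M i j • Z j)
  rw [h]
  refine h2.trans (Finset.sum_congr rfl fun r _ => ?_)
  exact (detRowAlternating (R := ℝ) (n := Fin N)).toMultilinearMap.map_smul_univ
    (fun i => M i (r i)) (fun i => Z (r i))

/-- A version of the Cauchy–Binet formula that sums over all maps rather than over subsets. -/
theorem factorial_mul_det_mul (M : Matrix (Fin N) (Fin n) ℝ) (Z : Matrix (Fin n) (Fin N) ℝ) :
    (Nat.factorial N : ℝ) * (M * Z).det =
      ∑ r : Fin N → Fin n, (M.submatrix id r).det * (Z.submatrix r id).det := by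
  have h : ∀ π : Equiv.Perm (Fin N), (M * Z).det = ∑ r : Fin N → Fin n,
      ((Equiv.Perm.sign π : ℤ) : ℝ) * (∏ i, M i (r (π i))) * (Z.submatrix r id).det := by
    intro π
    rw [det_mul_eq_sum_prod_mul_det, ← (Equiv.arrowCongr π (Equiv.refl (Fin n))).symm.sum_comp]
    refine Finset.sum_congr rfl fun r _ => ?_
    have h1 : (Z.submatrix (r ∘ π) id).det =
        ((Equiv.Perm.sign π : ℤ) : ℝ) * (Z.submatrix r id).det :=
      det_permute π (Z.submatrix r id)
    have h2 : (Equiv.arrowCongr π (Equiv.refl (Fin n))).symm r = r ∘ π := by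
      ext; simp [Equiv.arrowCongr]
    rw [h2, h1]
    simp only [Function.comp_apply]
    ring
  have h3 := Finset.sum_congr (rfl : (Finset.univ : Finset (Equiv.Perm (Fin N))) = _)
    fun π _ => h π
  rw [Finset.sum_const, Finset.sum_comm, Finset.card_univ, Fintype.card_perm, Fintype.card_fin,
    nsmul_eq_mul] at h3
  rw [h3]
  refine Finset.sum_congr rfl fun r _ => ?_
  rw [← Finset.sum_mul, ← det_transpose (M.submatrix id r), det_apply' (M.submatrix id r)ᵀ]
  rfl

theorem mul_det_mul_pos {M : Matrix (Fin N) (Fin n) ℝ} {Z : Matrix (Fin n) (Fin N) ℝ} {τ : ℝ}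
    (hZ : ∀ f : Fin N → Fin n, StrictMono f → 0 < (Z.submatrix f id).det)
    (hM : ∀ c : Fin N → Fin n, StrictMono c → 0 ≤ τ * (M.submatrix id c).det)
    (hM' : ∃ c : Fin N → Fin n, StrictMono c ∧ 0 < τ * (M.submatrix id c).det) :
    0 < τ * (M * Z).det := by
  have hfac : (0 : ℝ) < Nat.factorial N := by exact_mod_cast Nat.factorial_pos N
  refine pos_of_mul_pos_right (a := (Nat.factorial N : ℝ)) ?_ hfac.le
  rw [mul_left_comm, factorial_mul_det_mul, Finset.mul_sum]
  obtain ⟨c, hc, hpos⟩ := hM'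
  refine Finset.sum_pos' (fun r _ => ?_) ⟨c, Finset.mem_univ _, ?_⟩
  · by_cases hr : Function.Injective r
    · have hmono := strictMono_comp_sort hr
      have h1 : (M.submatrix id (r ∘ Tuple.sort r)).det = _ :=
        det_permute' (Tuple.sort r) (M.submatrix id r)
      have h2 : (Z.submatrix (r ∘ Tuple.sort r) id).det = _ :=
        det_permute (Tuple.sort r) (Z.submatrix r id)
      have h3 := mul_nonneg (hM _ hmono) (hZ _ hmono).le
      rw [h1, h2] at h3
      rcases Int.units_eq_one_or (Equiv.Perm.sign (Tuple.sort r)) with h | h <;>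
        rw [h] at h3 <;> push_cast at h3 <;> linarith
    · simp only [Function.Injective, not_forall] at hr
      obtain ⟨x, y, hxy, hne⟩ := hr
      have : (Z.submatrix r id).det = 0 := det_zero_of_row_eq hne (by ext; simp [hxy])
      simp [this]
  · rw [← mul_assoc]
    exact mul_pos hpos (hZ c hc)

end Matrix

theorem det_sum_domino {N : ℕ} (w a b : Fin N → Fin 3 → ℝ) (p : Fin N → Fin 3 → ℕ)
    (c : Fin N → ℕ) :
    (Matrix.of fun r t => ∑ s, w r s * dominoRow (p r s) (a r s) (b r s) (c t)).det =
      ∑ σ : Fin N → Fin 3, (∏ r, w r (σ r)) * (dominoMinor (fun r => p r (σ r))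
        (fun r => a r (σ r)) (fun r => b r (σ r)) c).det := by
  have h : (Matrix.of fun r t => ∑ s, w r s * dominoRow (p r s) (a r s) (b r s) (c t)) =
      fun r => ∑ s, w r s • fun t => dominoRow (p r s) (a r s) (b r s) (c t) := by
    ext r t
    simp [Finset.sum_apply]
  have h2 := (Matrix.detRowAlternating (R := ℝ) (n := Fin N)).toMultilinearMap.map_sum
    (fun r s => w r s • fun t => dominoRow (p r s) (a r s) (b r s) (c t))
  rw [h]
  refine h2.trans (Finset.sum_congr rfl fun σ _ => ?_)
  exact (Matrix.detRowAlternating (R := ℝ) (n := Fin N)).toMultilinearMap.map_smul_univ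
    (fun r => w r (σ r))
    (fun r t => dominoRow (p r (σ r)) (a r (σ r)) (b r (σ r)) (c t))

theorem dominoMinor_det_eq_zero_of_units {N : ℕ} (p : Fin N → ℕ) (a b : Fin N → ℝ) (c : Fin N → ℕ)
    {r u v : Fin N} (hu : u ≠ r) (hv : v ≠ r) (hpu : p u = p r) (hpv : p v = p r + 1)
    (hau : a u = 1) (hav : a v = 1) (hbu : b u = 0) (hbv : b v = 0) :
    (dominoMinor p a b c).det = 0 := by
  have h : dominoMinor p a b c = (dominoMinor p a b c).updateRow r
      (a r • dominoMinor p a b c u + b r • dominoMinor p a b c v) := by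
    ext x t
    by_cases hx : x = r
    · subst hx
      simp [dominoMinor, dominoRow, hpu, hpv, hau, hav, hbu, hbv]
    · simp [hx]
  rw [h, Matrix.det_updateRow_add, Matrix.det_updateRow_smul, Matrix.det_updateRow_smul,
    Matrix.det_updateRow_eq_zero hu, Matrix.det_updateRow_eq_zero hv]
  simp

theorem inversionSign_append {ι : Type*} [LinearOrder ι] {k d : ℕ} (κ : Fin k → ι) {κ' : Fin d → ι}
    (hκ' : StrictMono κ') : inversionSign (Fin.append κ κ') =
      inversionSign κ * ∏ l, ∏ u, if κ' u < κ l then -1 else 1 := by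
  have h1 : ∀ (u : Fin d) (l : Fin k), ¬ Fin.natAdd k u < Fin.castAdd d l := fun u l => by
    rw [Fin.lt_def]; simp; omega
  have h2 : ∀ (l : Fin k) (u : Fin d), Fin.castAdd d l < Fin.natAdd k u := fun l u => by
    rw [Fin.lt_def]; simp; omega
  have h3 : ∀ u v : Fin d, (if u < v ∧ κ' v < κ' u then (-1 : ℝ) else 1) = 1 := fun u v =>
    if_neg fun h => (hκ' h.1).not_gt h.2
  have h4 : ∀ l m : Fin k, Fin.castAdd d l < Fin.castAdd d m ↔ l < m := fun _ _ => Iff.rfl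
  simp only [inversionSign, Fin.prod_univ_add, Fin.append_left, Fin.append_right, h1, h2,
    false_and, if_false, true_and, Finset.prod_const_one, Fin.natAdd_lt_natAdd_iff, h3,
    mul_one, h4, Finset.prod_mul_distrib]

/-- The coefficient matrix of a twistor: the rows of `C` followed by four unit rows. -/
def twistorRows {n k : ℕ} (C : Matrix (Fin k) (Fin n) ℝ) (Q : Fin 4 → ℕ) :
    Matrix (Fin (k + 4)) (Fin n) ℝ :=
  Matrix.of (Fin.append (fun l a => C l a) fun u a => dominoRow (Q u) 1 0 (a + 1))

theorem twistorRows_castAdd {n k : ℕ} (C : Matrix (Fin k) (Fin n) ℝ) (Q : Fin 4 → ℕ) (l : Fin k)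
    (a : Fin n) : twistorRows C Q (Fin.castAdd 4 l) a = C l a := by
  simp [twistorRows]

theorem twistorRows_natAdd {n k : ℕ} (C : Matrix (Fin k) (Fin n) ℝ) (Q : Fin 4 → ℕ) (u : Fin 4)
    (a : Fin n) : twistorRows C Q (Fin.natAdd k u) a = dominoRow (Q u) 1 0 (a + 1) := by
  simp [twistorRows]

theorem twistor_mul {n k : ℕ} (C : Matrix (Fin k) (Fin n) ℝ) (Z : Matrix (Fin n) (Fin (k + 4)) ℝ)
    (Q : Fin 4 → ℕ) (hQ : ∀ u, 1 ≤ Q u ∧ Q u ≤ n) :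
    twistor Z (C * Z) Q = (twistorRows C Q * Z).det := by
  rw [twistor]
  congr 1
  ext r t
  induction r using Fin.addCases with
  | left l => simp [Matrix.mul_apply, twistorRows_castAdd]
  | right u =>
    obtain ⟨h1, h2⟩ := hQ u
    have h3 : Q u - 1 < n := by omega
    have h4 : ∀ a : Fin n, dominoRow (Q u) 1 0 (a + 1) = if a = ⟨Q u - 1, h3⟩ then 1 else 0 :=
      fun a => by
        have : (a : ℕ) + 1 = Q u ↔ a = ⟨Q u - 1, h3⟩ := by
          rw [Fin.ext_iff]; dsimp only; omega
        simp [dominoRow, this]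
    simp [Matrix.mul_apply, twistorRows_natAdd, markerRow, h3, h4]

namespace ChordDiagram

variable {n k : ℕ} {D : ChordDiagram n k} {α β γ δ ε : Fin k → ℝ}

theorem SignRules.pieceKey_eq_unit_iff (hs : D.SignRules α β γ δ ε) (l : Fin k) (t : Fin 3)
    (q : ℕ) : D.pieceKey α β γ δ ε l t = dominoKey q 1 0 ↔
      q = D.piecePos l t ∧ ¬ 0 < D.pieceRight β δ ε l t := by
  have h1 := hs.pieceLeft_pos l t
  have h2 := hs.pieceRight_nonneg l t
  rw [pieceKey, dominoKey_eq_iff, zero_div, div_eq_zero_iff, eq_comm (a := q), not_lt]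
  refine and_congr_right fun _ => ⟨fun h => ?_, fun h => Or.inl (le_antisymm h h2)⟩
  exact (h.resolve_right h1.ne').le

theorem SignRules.unit_lt_pieceKey_iff (hs : D.SignRules α β γ δ ε) (l : Fin k) (t : Fin 3)
    (q : ℕ) : dominoKey q 1 0 < D.pieceKey α β γ δ ε l t ↔
      q < D.piecePos l t ∨ q = D.piecePos l t ∧ 0 < D.pieceRight β δ ε l t := by
  rw [pieceKey, dominoKey_lt_iff, zero_div, div_pos_iff_of_pos_right (hs.pieceLeft_pos l t)]

theorem piecePos_pos (l : Fin k) (t : Fin 3) : 1 ≤ D.piecePos l t := by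
  have h1 := D.one_le_tail l
  have h2 := tail_lt_head (D := D) l
  have h3 := head_lt (D := D) l
  have h4 := D.one_le_tail (D.parent l)
  fin_cases t
  · exact h1
  · exact h1.trans h2.le
  · simp only [piecePos, Fin.reduceFinMk, Matrix.cons_val]
    split_ifs <;> omega

theorem piecePos_lt (l : Fin k) (t : Fin 3) (ht : t = 2 → ¬ D.IsTop l) : D.piecePos l t < n := by
  fin_cases t
  · exact tail_lt l
  · exact head_lt l
  · simp only [piecePos, Fin.reduceFinMk, Matrix.cons_val, ht rfl, if_false]
    exact tail_lt _

theorem piecePos_le (l : Fin k) (t : Fin 3) : D.piecePos l t ≤ n := by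
  by_cases ht : t = 2 ∧ D.IsTop l
  · obtain ⟨rfl, h⟩ := ht
    simp [piecePos, h]
  · exact (piecePos_lt l t (by tauto)).le

theorem pieceRight_of_isTop {l : Fin k} (h : D.IsTop l) : D.pieceRight β δ ε l 2 = 0 := by
  simp [pieceRight, h]

/-- Signs of the twistors whose four unit rows `Q` have a constant parity of inversions against
all dominoes that occur in the domino matrix. -/
theorem SignRules.twistor_pos (hs : D.SignRules α β γ δ ε) {Z : Matrix (Fin n) (Fin (k + 4)) ℝ}
    (hZ : IsPositiveMatrix Z) {Q : Fin 4 → ℕ} (hQ : StrictMono Q)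
    (hQn : ∀ u, 1 ≤ Q u ∧ Q u ≤ n) {τ : ℝ}
    (hτ : ∀ (p : ℕ) (P : Prop), 1 ≤ p → p ≤ n → (p = n → ¬ P) → (∀ u, Q u = p → P) →
      (∀ u v, Q u = p → Q v ≠ p + 1) →
      ∏ u, (if Q u < p ∨ Q u = p ∧ P then -1 else 1) = τ)
    {σ : Fin k → Fin 3} {g : Fin k → ℕ}
    (hσ : Function.Injective fun l => D.pieceKey α β γ δ ε l (σ l))
    (hg : Function.Injective g) (hgQ : ∀ l u, g l ≠ Q u)
    (hgσ : ∀ l, g l = D.piecePos l (σ l) ∨ (g l = D.piecePos l (σ l) + 1 ∧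
      (σ l = 2 → ¬ D.IsTop l))) :
    0 < τ ^ k * twistor Z (D.dominoMatrix α β γ δ ε * Z) Q := by
  set w : Fin (k + 4) → Fin 3 → ℝ := Fin.append D.pieceSign fun _ => ![1, 0, 0] with hw
  set p : Fin (k + 4) → Fin 3 → ℕ := Fin.append D.piecePos fun u _ => Q u with hp
  set a : Fin (k + 4) → Fin 3 → ℝ := Fin.append (D.pieceLeft α γ ε) fun _ _ => 1 with ha
  set b : Fin (k + 4) → Fin 3 → ℝ := Fin.append (D.pieceRight β δ ε) fun _ _ => 0 with hb
  have hapos : ∀ r s, 0 < a r s := fun r s => by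
    induction r using Fin.addCases with
    | left l => simpa [ha] using hs.pieceLeft_pos l s
    | right u => simp [ha]
  have hbnonneg : ∀ r s, 0 ≤ b r s := fun r s => by
    induction r using Fin.addCases with
    | left l => simpa [hb] using hs.pieceRight_nonneg l s
    | right u => simp [hb]
  have hrows : ∀ c : Fin (k + 4) → Fin n,
      (twistorRows (D.dominoMatrix α β γ δ ε) Q).submatrix id c =
      Matrix.of fun r t => ∑ s, w r s * dominoRow (p r s) (a r s) (b r s) (c t + 1) := fun c => by
    ext r t
    induction r using Fin.addCases with
    | left l => simp [twistorRows_castAdd, hw, hp, ha, hb, hs.dominoMatrix_apply]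
    | right u => simp [twistorRows_natAdd, hw, hp, ha, hb, Fin.sum_univ_three]
  have hkey : ∀ ρ : Fin (k + 4) → Fin 3,
      (fun r => dominoKey (p r (ρ r)) (a r (ρ r)) (b r (ρ r))) =
      Fin.append (fun l => D.pieceKey α β γ δ ε l (ρ (Fin.castAdd 4 l)))
        (fun u => dominoKey (Q u) 1 0) := fun ρ => by
    ext1 r
    induction r using Fin.addCases with
    | left l => simp [hp, ha, hb, pieceKey]
    | right u => simp [hp, ha, hb]
  have hQkey : StrictMono fun u => dominoKey (Q u) 1 0 := fun u v huv =>
    dominoKey_lt_iff.2 (Or.inl (hQ huv))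
  have hsign : ∀ ρ : Fin (k + 4) → Fin 3, (∀ u, ρ (Fin.natAdd k u) = 0) →
      Function.Injective (fun r => dominoKey (p r (ρ r)) (a r (ρ r)) (b r (ρ r))) →
      (∀ l u v, Q u = D.piecePos l (ρ (Fin.castAdd 4 l)) →
        Q v ≠ D.piecePos l (ρ (Fin.castAdd 4 l)) + 1) →
      τ ^ k * ∏ r, w r (ρ r) =
        inversionSign (fun r => dominoKey (p r (ρ r)) (a r (ρ r)) (b r (ρ r))) := by
    intro ρ hρ hinj hblock
    rw [hkey, Fin.append_injective_iff] at hinj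
    rw [hkey, inversionSign_append _ hQkey, ← hs.prod_pieceSign _ hinj.1, Fin.prod_univ_add,
      mul_comm]
    have h1 : ∏ u, w (Fin.natAdd k u) (ρ (Fin.natAdd k u)) = 1 :=
      Finset.prod_eq_one fun u _ => by simp [hw, hρ]
    have h2 : ∀ l : Fin k, ∏ u, (if dominoKey (Q u) 1 0 <
        D.pieceKey α β γ δ ε l (ρ (Fin.castAdd 4 l)) then (-1 : ℝ) else 1) = τ := fun l => by
      simp only [hs.unit_lt_pieceKey_iff]
      refine hτ _ _ (piecePos_pos _ _) (piecePos_le _ _) (fun hn hpos => ?_) (fun u hu => ?_)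
        (hblock l)
      · by_cases ht : ρ (Fin.castAdd 4 l) = 2 ∧ D.IsTop l
        · rw [ht.1, pieceRight_of_isTop ht.2] at hpos
          exact hpos.false
        · exact (piecePos_lt l _ (by tauto)).ne hn
      · by_contra hpos
        exact hinj.2.2 l u ((hs.pieceKey_eq_unit_iff l _ _).2 ⟨hu, hpos⟩)
    rw [h1, mul_one, Finset.prod_congr rfl fun l _ => h2 l, Finset.prod_const, Finset.card_univ,
      Fintype.card_fin]
    simp [hw]
  have hterm : ∀ (c : Fin (k + 4) → ℕ), StrictMono c → ∀ ρ : Fin (k + 4) → Fin 3,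
      0 ≤ τ ^ k * ((∏ r, w r (ρ r)) * (dominoMinor (fun r => p r (ρ r)) (fun r => a r (ρ r))
        (fun r => b r (ρ r)) c).det) := by
    intro c hc ρ
    by_cases hρ : ∀ u, ρ (Fin.natAdd k u) = 0
    · by_cases hinj : Function.Injective
        (fun r => dominoKey (p r (ρ r)) (a r (ρ r)) (b r (ρ r)))
      · by_cases hblock : ∀ l u v, Q u = D.piecePos l (ρ (Fin.castAdd 4 l)) →
            Q v ≠ D.piecePos l (ρ (Fin.castAdd 4 l)) + 1
        · rw [← mul_assoc, hsign ρ hρ hinj hblock]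
          exact (inversionSign_mul_dominoMinor_det_nonneg _ _ _ c hinj (fun _ => hapos _ _)
            (fun _ => hbnonneg _ _) hc).1
        · push Not at hblock
          obtain ⟨l, u, v, hu, hv⟩ := hblock
          have hne : ∀ u : Fin 4, Fin.natAdd k u ≠ Fin.castAdd 4 l := fun u h => by
            have := congrArg Fin.val h
            simp at this
            omega
          rw [dominoMinor_det_eq_zero_of_units _ _ _ c (hne u) (hne v)] <;>
            simp [hp, ha, hb, hu, hv]
      · rw [dominoMinor_det_eq_zero_of_not_injective _ _ _ c (fun _ => hapos _ _) hinj]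
        simp
    · push Not at hρ
      obtain ⟨u, hu⟩ := hρ
      have : ∏ r, w r (ρ r) = 0 := Finset.prod_eq_zero (Finset.mem_univ (Fin.natAdd k u)) (by
        generalize ρ (Fin.natAdd k u) = t at hu
        fin_cases t <;> simp [hw] at hu ⊢)
      simp [this]
  rw [twistor_mul _ _ _ hQn]
  refine Matrix.mul_det_mul_pos hZ (fun c hc => ?_) ?_
  · rw [hrows, det_sum_domino _ _ _ _ fun t => (c t : ℕ) + 1, Finset.mul_sum]
    exact Finset.sum_nonneg fun ρ _ => hterm _ (fun x y h => Nat.succ_lt_succ (hc h)) ρ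
  · set ρ : Fin (k + 4) → Fin 3 := Fin.append σ fun _ => 0 with hρ
    have hblock : ∀ l u v, Q u = D.piecePos l (ρ (Fin.castAdd 4 l)) →
        Q v ≠ D.piecePos l (ρ (Fin.castAdd 4 l)) + 1 := fun l u v hu hv => by
      simp only [hρ, Fin.append_left] at hu hv
      rcases hgσ l with h | h
      · exact hgQ l u (by rw [h, hu])
      · exact hgQ l v (by rw [h.1, hv])
    have hinj : Function.Injective
        (fun r => dominoKey (p r (ρ r)) (a r (ρ r)) (b r (ρ r))) := by
      rw [hkey, Fin.append_injective_iff]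
      refine ⟨by simpa [hρ] using hσ, hQkey.injective, fun l u h => ?_⟩
      simp only [hρ, Fin.append_left] at h
      obtain ⟨h1, h2⟩ := (hs.pieceKey_eq_unit_iff l _ _).1 h
      rcases hgσ l with h' | h'
      · exact hgQ l u (by rw [h', h1])
      · exact h2 (hs.pieceRight_pos l _ h'.2)
    obtain ⟨c, hc, hcg, hpos⟩ := exists_inversionSign_mul_dominoMinor_det_pos
      (fun r => p r (ρ r)) (fun r => a r (ρ r)) (fun r => b r (ρ r)) hinj (fun _ => hapos _ _)
      (fun _ => hbnonneg _ _) (Fin.append g Q)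
      (Fin.append_injective_iff.2 ⟨hg, hQ.injective, hgQ⟩) (fun r => by
        induction r using Fin.addCases with
        | left l =>
          simp only [hp, hb, hρ, Fin.append_left]
          exact (hgσ l).imp_right fun h => ⟨h.1, hs.pieceRight_pos l _ h.2⟩
        | right u => simp [hp, hρ])
    have hcn : ∀ t, 1 ≤ c t ∧ c t ≤ n := fun t => by
      obtain ⟨r, hr⟩ := hcg t
      rw [hr]
      induction r using Fin.addCases with
      | left l =>
        rw [Fin.append_left]
        have h1 := piecePos_pos (D := D) l (σ l)
        have h2 := piecePos_le (D := D) l (σ l)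
        rcases hgσ l with h | h
        · omega
        · have := piecePos_lt l _ h.2
          omega
      | right u => simpa using hQn u
    have hcv : ∀ t, c t - 1 + 1 = c t := fun t => Nat.sub_add_cancel (hcn t).1
    refine ⟨fun t => ⟨c t - 1, by have := hcn t; omega⟩, fun x y hxy => ?_, ?_⟩
    · have h1 := hc hxy
      have h2 := hcv x
      have h3 := hcv y
      rw [Fin.lt_def]
      dsimp only
      omega
    · rw [hrows, det_sum_domino _ _ _ _ fun t => c t - 1 + 1, Finset.mul_sum]
      simp only [hcv]
      refine Finset.sum_pos' (fun ρ _ => hterm c hc ρ) ⟨ρ, Finset.mem_univ _, ?_⟩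
      rw [← mul_assoc, hsign ρ (fun u => by simp [hρ]) hinj hblock]
      exact hpos

end ChordDiagram

namespace ChordDiagram

variable {n k : ℕ} {D : ChordDiagram n k} {α β γ δ ε : Fin k → ℝ}

theorem SignRules.pieceKey_zero_ne_one (hs : D.SignRules α β γ δ ε) (l m : Fin k) :
    D.pieceKey α β γ δ ε l 0 ≠ D.pieceKey α β γ δ ε m 1 := by
  rcases lt_or_ge (D.tail l) (D.head m) with h | h
  · exact (hs.pieceKey_zero_lt_one_iff.2 h).ne
  · exact (hs.pieceKey_one_lt_zero_iff.2 h).ne'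

theorem SignRules.pieceKey_one_ne_of_lt (hs : D.SignRules α β γ δ ε) {l m : Fin k} (h : l < m) :
    D.pieceKey α β γ δ ε l 1 ≠ D.pieceKey α β γ δ ε m 1 := by
  by_cases hd : D.Descendant l m
  · exact ((hs.pieceKey_one_lt_one_iff h).2 hd).ne'
  · have h1 : D.head l ≤ D.tail m := not_lt.1 fun h' => hd ((descendant_iff_of_lt h).2 h')
    have h2 : D.head l < D.head m := h1.trans_lt (tail_lt_head m)
    rw [hs.pieceKey_one, hs.pieceKey_one]
    exact (Prod.Lex.toLex_lt_toLex.2 (Or.inl h2)).ne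

theorem pieceKey_zero_injective : Function.Injective fun l => D.pieceKey α β γ δ ε l 0 :=
  fun l m h => by
    rcases lt_trichotomy l m with h' | h' | h'
    · exact absurd h (pieceKey_zero_lt_iff.2 h').ne
    · exact h'
    · exact absurd h (pieceKey_zero_lt_iff.2 h').ne'

/-- The dominoes chosen in distinct rows have distinct keys as soon as, whenever a row uses its
inherited domino, so does its parent, and rows using it are comparable. -/
theorem SignRules.pieceKey_injective (hs : D.SignRules α β γ δ ε) {σ : Fin k → Fin 3}
    (hpar : ∀ l, σ l = 2 → ¬ D.IsTop l → σ (D.parent l) = 2)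
    (hcomp : ∀ l m, l < m → σ l = 2 → σ m = 2 → D.Descendant l m) :
    Function.Injective fun l => D.pieceKey α β γ δ ε l (σ l) := by
  have key : ∀ l m, l < m → D.pieceKey α β γ δ ε l (σ l) ≠ D.pieceKey α β γ δ ε m (σ m) := by
    have h0 : ∀ l m, σ l = 2 → σ m = 0 →
        D.pieceKey α β γ δ ε l (σ l) ≠ D.pieceKey α β γ δ ε m (σ m) := fun l m hl hm => by
      rw [hl, hm]
      by_cases h : D.IsTop l
      · exact (hs.pieceKey_lt_of_isTop h (by simp)).ne'
      · rw [hs.pieceKey_two_of_not_isTop h]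
        intro he
        have := hpar l hl h
        rw [pieceKey_zero_injective he, hm] at this
        simp at this
    have h1 : ∀ l m, σ l = 2 → σ m = 1 →
        D.pieceKey α β γ δ ε l (σ l) ≠ D.pieceKey α β γ δ ε m (σ m) := fun l m hl hm => by
      rw [hl, hm]
      by_cases h : D.IsTop l
      · exact (hs.pieceKey_lt_of_isTop h (by simp)).ne'
      · rw [hs.pieceKey_two_of_not_isTop h]
        exact hs.pieceKey_zero_ne_one _ _
    have hcases : ∀ l, σ l = 0 ∨ σ l = 1 ∨ σ l = 2 := fun l => by
      generalize σ l = t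
      fin_cases t <;> simp
    intro l m hlm
    rcases hcases l with hl | hl | hl <;> rcases hcases m with hm | hm | hm
    · rw [hl, hm]; exact fun h => hlm.ne (pieceKey_zero_injective h)
    · rw [hl, hm]; exact hs.pieceKey_zero_ne_one l m
    · exact (h0 m l hm hl).symm
    · rw [hl, hm]; exact (hs.pieceKey_zero_ne_one m l).symm
    · rw [hl, hm]; exact hs.pieceKey_one_ne_of_lt hlm
    · exact (h1 m l hm hl).symm
    · exact h0 l m hl hm
    · exact h1 l m hl hm
    · have hd := hcomp l m hlm hl hm
      have ht : ¬ D.IsTop m := fun h => h l hd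
      rw [hl, hm, hs.pieceKey_two_of_not_isTop ht]
      by_cases h : D.IsTop l
      · exact (hs.pieceKey_lt_of_isTop h (by simp)).ne'
      · rw [hs.pieceKey_two_of_not_isTop h]
        intro he
        have h1 := (isParent_parent ht).le_of_descendant hd
        rw [← pieceKey_zero_injective he] at h1
        exact h1.not_gt (isParent_parent h).lt
  intro l m h
  rcases lt_trichotomy l m with h' | h' | h'
  · exact absurd h (key l m h')
  · exact h'
  · exact absurd h.symm (key m l h')

variable (D) in
/-- The four markers of a chord. -/
def markers (l : Fin k) : Finset ℕ := {D.tail l, D.tail l + 1, D.head l, D.head l + 1}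

theorem mem_markers {l : Fin k} {x : ℕ} : x ∈ D.markers l ↔
    x = D.tail l ∨ x = D.tail l + 1 ∨ x = D.head l ∨ x = D.head l + 1 := by
  simp [markers]

theorem bounds_of_mem_markers {l : Fin k} {x : ℕ} (h : x ∈ D.markers l) :
    D.tail l ≤ x ∧ x < n := by
  rw [mem_markers] at h
  have := D.tail_add_two_le_head l
  have := D.head_add_two_le l
  omega

theorem card_add_three_le {S : Finset (Fin k)} (hS : S.Nonempty) :
    S.card + 3 ≤ (S.biUnion D.markers).card := by
  obtain ⟨t, ht, htmax⟩ := S.exists_max_image D.tail hS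
  obtain ⟨h, hh, hhmax⟩ := S.exists_max_image D.head hS
  have h1 := D.tail_add_two_le_head t
  have h2 := hhmax t ht
  have hT : ∀ x ∈ S.image D.tail, x ≤ D.tail t := fun x hx => by
    obtain ⟨l, hl, rfl⟩ := Finset.mem_image.1 hx
    exact htmax l hl
  have hcard : (insert (D.head h + 1) (insert (D.head h)
      (insert (D.tail t + 1) (S.image D.tail)))).card = S.card + 3 := by
    rw [Finset.card_insert_of_notMem, Finset.card_insert_of_notMem, Finset.card_insert_of_notMem,
      Finset.card_image_of_injective _ D.tail_strictMono.injective]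
    · intro hx
      have := hT _ hx
      omega
    · rw [Finset.mem_insert]
      rintro (hx | hx)
      · omega
      · have := hT _ hx
        omega
    · rw [Finset.mem_insert, Finset.mem_insert]
      rintro (hx | hx | hx)
      · omega
      · omega
      · have := hT _ hx
        omega
  rw [← hcard]
  refine Finset.card_le_card ?_
  simp only [Finset.insert_subset_iff, Finset.mem_biUnion, mem_markers]
  refine ⟨⟨h, hh, by tauto⟩, ⟨h, hh, by tauto⟩, ⟨t, ht, by tauto⟩, fun x hx => ?_⟩
  obtain ⟨l, hl, rfl⟩ := Finset.mem_image.1 hx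
  exact Finset.mem_biUnion.2 ⟨l, hl, mem_markers.2 (Or.inl rfl)⟩

/-- Hall's theorem for the markers of the chords from the `m`-th on: either they have distinct
representatives avoiding `Q`, or `Q` lies among their markers. -/
theorem exists_representatives_or {Q : Finset ℕ} (hQ : Q.card = 4) (m : ℕ) :
    (∃ f : Fin k → ℕ, Set.InjOn f {t | m ≤ t.val} ∧
      ∀ t : Fin k, m ≤ t.val → f t ∈ D.markers t \ Q) ∨
    ∀ q ∈ Q, ∃ t : Fin k, m ≤ t.val ∧ q ∈ D.markers t := by
  by_cases hall : ∀ S : Finset {t : Fin k // m ≤ t.val},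
      S.card ≤ (S.biUnion fun t => D.markers t.1 \ Q).card
  · obtain ⟨f, hf, hfm⟩ := (Finset.all_card_le_biUnion_card_iff_exists_injective _).1 hall
    refine Or.inl ⟨fun t => if h : m ≤ t.val then f ⟨t, h⟩ else 0, fun x hx y hy hxy => ?_,
      fun t ht => ?_⟩
    · simp only [Set.mem_ofPred_eq] at hx hy
      simp only [hx, hy, dif_pos] at hxy
      exact congrArg Subtype.val (hf hxy)
    · simp only [ht, dif_pos]
      exact hfm ⟨t, ht⟩
  · push Not at hall
    obtain ⟨S, hS⟩ := hall
    have hne : S.Nonempty := by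
      rw [Finset.nonempty_iff_ne_empty]
      rintro rfl
      simp at hS
    have h1 := card_add_three_le (D := D) (S := S.map (Function.Embedding.subtype _))
      (hne.map)
    rw [Finset.card_map] at h1
    set U := (S.map (Function.Embedding.subtype _)).biUnion D.markers with hU
    have h2 : (S.biUnion fun t => D.markers t.1 \ Q) = U \ Q := by
      ext x
      simp only [hU, Finset.mem_biUnion, Finset.mem_sdiff, Finset.mem_map,
        Function.Embedding.subtype_apply]
      constructor
      · rintro ⟨t, ht, hx, hxQ⟩
        exact ⟨⟨t.1, ⟨t, ht, rfl⟩, hx⟩, hxQ⟩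
      · rintro ⟨⟨_, ⟨t, ht, rfl⟩, hx⟩, hxQ⟩
        exact ⟨t, ht, hx, hxQ⟩
    have h3 : (U \ Q).card + (U ∩ Q).card = U.card := Finset.card_sdiff_add_card_inter U Q
    have h4 : U ∩ Q = Q := Finset.eq_of_subset_of_card_le Finset.inter_subset_right (by
      rw [h2] at hS
      omega)
    refine Or.inr fun q hq => ?_
    rw [← h4, Finset.mem_inter, hU, Finset.mem_biUnion] at hq
    obtain ⟨⟨t, ht, hqt⟩, -⟩ := hq
    obtain ⟨t, -, rfl⟩ := Finset.mem_map.1 ht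
    exact ⟨t.1, t.2, hqt⟩

theorem SignRules.exists_representatives (hs : D.SignRules α β γ δ ε) {Q : Fin 4 → ℕ}
    (hQ : Function.Injective Q) : ∃ (σ : Fin k → Fin 3) (g : Fin k → ℕ),
      (Function.Injective fun l => D.pieceKey α β γ δ ε l (σ l)) ∧ Function.Injective g ∧
      (∀ l u, g l ≠ Q u) ∧ ∀ l, g l = D.piecePos l (σ l) ∨ (g l = D.piecePos l (σ l) + 1 ∧
        (σ l = 2 → ¬ D.IsTop l)) := by
  set R : Finset ℕ := Finset.univ.image Q with hR
  have hRcard : R.card = 4 := by rw [hR, Finset.card_image_of_injective _ hQ]; simp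
  have hRQ : ∀ {x : ℕ}, x ∉ R → ∀ u, x ≠ Q u := fun hx u h =>
    hx (h ▸ Finset.mem_image_of_mem Q (Finset.mem_univ u))
  set P : ℕ → Prop := fun m => ∃ f : Fin k → ℕ, Set.InjOn f {t | m ≤ t.val} ∧
    ∀ t : Fin k, m ≤ t.val → f t ∈ D.markers t \ R with hP
  set σ₀ : (Fin k → ℕ) → Fin k → Fin 3 := fun f t =>
    if f t = D.tail t ∨ f t = D.tail t + 1 then 0 else 1 with hσ₀
  have hσ₀2 : ∀ f t, σ₀ f t ≠ 2 := fun f t => by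
    simp only [hσ₀]
    split_ifs <;> simp
  have hσ₀g : ∀ f t, f t ∈ D.markers t →
      f t = D.piecePos t (σ₀ f t) ∨ f t = D.piecePos t (σ₀ f t) + 1 := fun f t ht => by
    rw [mem_markers] at ht
    simp only [hσ₀]
    split_ifs with h
    · exact h
    · simp only [piecePos, Matrix.cons_val]
      tauto
  by_cases h0 : P 0
  · obtain ⟨f, hf, hfm⟩ := h0
    refine ⟨σ₀ f, f, hs.pieceKey_injective (fun l h => absurd h (hσ₀2 f l))
      (fun l _ _ h => absurd h (hσ₀2 f l)), fun x y h => hf (Nat.zero_le _) (Nat.zero_le _) h,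
      fun l => hRQ (Finset.mem_sdiff.1 (hfm l (Nat.zero_le _))).2, fun l => ?_⟩
    exact (hσ₀g f l (Finset.mem_sdiff.1 (hfm l (Nat.zero_le _))).1).imp_right
      fun h => ⟨h, fun h' => absurd h' (hσ₀2 f l)⟩
  · have hPk : P k := ⟨0, fun x hx => absurd x.2 (not_lt.2 hx),
      fun x hx => absurd x.2 (not_lt.2 hx)⟩
    obtain ⟨l₀, hl₀k, hl₀, hl₀'⟩ : ∃ m, m < k ∧ ¬ P m ∧ P (m + 1) := by
      by_contra! hcon
      exact h0 (Nat.decreasingInduction (motive := fun m _ => P m)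
        (fun m hm h => by_contra fun h' => hcon m hm h' h) hPk (Nat.zero_le k))
    obtain ⟨f, hf, hfm⟩ := hl₀'
    have hbound : ∀ u, ∃ t : Fin k, l₀ ≤ t.val ∧ Q u ∈ D.markers t := fun u =>
      (exists_representatives_or (D := D) hRcard l₀).resolve_left hl₀ (Q u)
        (Finset.mem_image_of_mem Q (Finset.mem_univ u))
    set a : Fin k := ⟨l₀, hl₀k⟩ with ha
    have hQa : ∀ u, D.tail a ≤ Q u ∧ Q u < n := fun u => by
      obtain ⟨t, ht, hu⟩ := hbound u
      have h1 := bounds_of_mem_markers hu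
      have h2 : D.tail a ≤ D.tail t := D.tail_strictMono.monotone ht
      omega
    set A : Fin k → Prop := fun t => t = a ∨ D.Descendant t a with hA
    have hAle : ∀ t, A t → t ≤ a := fun t ht => ht.elim le_of_eq fun h => h.lt.le
    have hAcomp : ∀ l m, l < m → A l → A m → D.Descendant l m := fun l m hlm hl hm => by
      have hla : D.Descendant l a := hl.resolve_left fun h =>
        (hAle m hm).not_gt (h ▸ hlm)
      rcases hm with rfl | hm
      · exact hla
      · exact hla.of_between hlm hm.lt
    have hApar : ∀ l, A l → ¬ D.IsTop l → D.Descendant (D.parent l) a := fun l hl ht => by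
      have h1 := (isParent_parent ht).1
      rcases hl with rfl | hl
      · exact h1
      · exact h1.trans hl
    set σ : Fin k → Fin 3 := fun t => if a < t then σ₀ f t else if A t then 2 else 0 with hσ
    set g : Fin k → ℕ := fun t => if a < t then f t else if A t then
      (if D.IsTop t then n else D.tail (D.parent t)) else D.tail t with hg
    have hσA : ∀ t, σ t = 2 ↔ A t := fun t => by
      simp only [hσ]
      split_ifs with h1 h2
      · exact iff_of_false (hσ₀2 f t) fun h => (hAle t h).not_gt h1
      · simp [h2]
      · simp [h2]
    have hfm' : ∀ t, a < t → f t ∈ D.markers t \ R := fun t ht => hfm t ht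
    have hgf : ∀ t, a < t → g t = f t ∧ D.tail a < f t ∧ f t < n := fun t ht => by
      have h1 := bounds_of_mem_markers (Finset.mem_sdiff.1 (hfm' t ht)).1
      have h2 : D.tail a < D.tail t := D.tail_strictMono ht
      refine ⟨by simp [hg, ht], by omega, h1.2⟩
    have hgtop : ∀ t, A t → D.IsTop t → g t = n := fun t ht ht' => by
      simp [hg, (hAle t ht).not_gt, ht, ht']
    have hgpar : ∀ t, A t → ¬ D.IsTop t → g t = D.tail (D.parent t) := fun t ht ht' => by
      simp [hg, (hAle t ht).not_gt, ht, ht']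
    have hgtail : ∀ t, ¬ a < t → ¬ A t → g t = D.tail t := fun t ht ht' => by
      simp [hg, ht, ht']
    have hsmall : ∀ t, ¬ a < t → g t < D.tail a ∨ (g t = n ∧ A t ∧ D.IsTop t) := fun t ht => by
      by_cases hAt : A t
      · by_cases htop : D.IsTop t
        · exact Or.inr ⟨hgtop t hAt htop, hAt, htop⟩
        · rw [hgpar t hAt htop]
          exact Or.inl (hApar t hAt htop).1
      · rw [hgtail t ht hAt]
        exact Or.inl (D.tail_strictMono ((not_lt.1 ht).lt_of_ne fun h => hAt (Or.inl h)))
    have hginj : ∀ l m, l < m → g l ≠ g m := by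
      intro l m hlm he
      have han : D.tail a < n := tail_lt a
      by_cases hl : a < l
      · have hm := hl.trans hlm
        rw [(hgf l hl).1, (hgf m hm).1] at he
        exact hlm.ne (hf hl hm he)
      · have h1 := hsmall l hl
        by_cases hm : a < m
        · have := hgf m hm
          omega
        · have h2 := hsmall m hm
          by_cases hAl : A l
          · by_cases htl : D.IsTop l
            · have h3 := hgtop l hAl htl
              have h4 : A m ∧ D.IsTop m := by
                rcases h2 with h2 | h2
                · omega
                · exact h2.2
              exact h4.2 l (hAcomp l m hlm hAl h4.1)
            · have hAp := hApar l hAl htl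
              have h3 := hgpar l hAl htl
              by_cases hAm : A m
              · have hd := hAcomp l m hlm hAl hAm
                have htm : ¬ D.IsTop m := fun h => h l hd
                have h4 := hgpar m hAm htm
                have h5 : D.parent l = D.parent m := D.tail_strictMono.injective (by omega)
                have h6 := (isParent_parent htm).le_of_descendant hd
                exact h6.not_gt (h5 ▸ (isParent_parent htl).lt)
              · have h4 := hgtail m hm hAm
                have h5 : D.parent l = m := D.tail_strictMono.injective (by omega)
                exact hAm (Or.inr (h5 ▸ hAp))
          · have h3 := hgtail l hl hAl
            by_cases hAm : A m
            · by_cases htm : D.IsTop m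
              · have h4 := hgtop m hAm htm
                have := tail_lt (D := D) l
                omega
              · have h4 := hgpar m hAm htm
                have h5 : D.parent m = l := D.tail_strictMono.injective (by omega)
                exact hAl (Or.inr (h5 ▸ hApar m hAm htm))
            · have h4 := hgtail m hm hAm
              exact hlm.ne (D.tail_strictMono.injective (by omega))
    refine ⟨σ, g, hs.pieceKey_injective (fun l hl ht => ?_) (fun l m hlm hl hm => ?_),
      fun l m he => ?_, fun l u he => ?_, fun l => ?_⟩
    · exact (hσA _).2 (Or.inr (hApar l ((hσA l).1 hl) ht))
    · exact hAcomp l m hlm ((hσA l).1 hl) ((hσA m).1 hm)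
    · rcases lt_trichotomy l m with h | h | h
      · exact absurd he (hginj l m h)
      · exact h
      · exact absurd he.symm (hginj m l h)
    · have h1 := hQa u
      by_cases hl : a < l
      · rw [(hgf l hl).1] at he
        exact hRQ (Finset.mem_sdiff.1 (hfm' l hl)).2 u he
      · have := hsmall l hl
        omega
    · by_cases hl : a < l
      · have h1 : σ l = σ₀ f l := by simp [hσ, hl]
        rw [h1, (hgf l hl).1]
        exact (hσ₀g f l (Finset.mem_sdiff.1 (hfm' l hl)).1).imp_right
          fun h => ⟨h, fun h' => absurd h' (hσ₀2 f l)⟩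
      · left
        by_cases hAl : A l
        · simp [hσ, hg, hl, hAl, piecePos]
        · simp [hσ, hg, hl, hAl, piecePos]

end ChordDiagram

/-- The twistor as an alternating function of the rows of `Y` and the four further rows. -/
def twistorForm (k : ℕ) : (Fin (k + 4) → ℝ) [⋀^Fin k ⊕ Fin 4]→ₗ[ℝ] ℝ :=
  Matrix.detRowAlternating.domDomCongr finSumFinEquiv.symm

theorem twistor_eq_twistorForm {n k : ℕ} (Z : Matrix (Fin n) (Fin (k + 4)) ℝ)
    (Y : Matrix (Fin k) (Fin (k + 4)) ℝ) (a : Fin 4 → ℕ) :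
    twistor Z Y a = twistorForm k (Sum.elim Y fun t => markerRow Z (a t)) := by
  unfold twistor twistorForm
  rw [AlternatingMap.domDomCongr_apply]
  rfl

theorem twistor_comp_perm {n k : ℕ} (Z : Matrix (Fin n) (Fin (k + 4)) ℝ)
    (Y : Matrix (Fin k) (Fin (k + 4)) ℝ) (a : Fin 4 → ℕ) (π : Equiv.Perm (Fin 4)) :
    twistor Z Y (a ∘ π) = ((Equiv.Perm.sign π : ℤ) : ℝ) * twistor Z Y a := by
  have h : (Sum.elim Y fun t => markerRow Z ((a ∘ π) t)) =
      (Sum.elim Y fun t => markerRow Z (a t)) ∘ Equiv.Perm.sumCongr (1 : Equiv.Perm (Fin k)) π := by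
    ext s
    cases s <;> rfl
  rw [twistor_eq_twistorForm, twistor_eq_twistorForm, h, AlternatingMap.map_perm,
    Equiv.Perm.sign_sumCongr, Equiv.Perm.sign_one, one_mul, Units.smul_def, zsmul_eq_mul]

theorem twistor_exchange {n k : ℕ} {Z : Matrix (Fin n) (Fin (k + 4)) ℝ}
    {Y : Matrix (Fin k) (Fin (k + 4)) ℝ} {a : Fin 4 → ℕ} {l : Fin k} {c : Fin 4 → ℝ} {e : ℝ} {q : ℕ}
    (h : Y l = (∑ t, c t • markerRow Z (a t)) + e • markerRow Z q) (s : Fin 4) :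
    e * twistor Z Y (Function.update a s q) = -(c s * twistor Z Y a) := by
  set v := Sum.elim Y fun t => markerRow Z (a t) with hv
  have h0 : twistorForm k (Function.update v (Sum.inr s) (v (Sum.inl l))) = 0 :=
    AlternatingMap.map_update_self _ _ (by simp)
  have h1 : ∀ t, twistorForm k (Function.update v (Sum.inr s) (c t • markerRow Z (a t))) =
      if t = s then c s * twistor Z Y a else 0 := by
    intro t
    rw [AlternatingMap.map_update_smul]
    split_ifs with hts
    · subst hts
      rw [twistor_eq_twistorForm, ← hv, show markerRow Z (a t) = v (Sum.inr t) from rfl,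
        Function.update_eq_self, smul_eq_mul]
    · rw [show markerRow Z (a t) = v (Sum.inr t) from rfl,
        AlternatingMap.map_update_self _ _ (by simpa using Ne.symm hts), smul_zero]
  have h2 : twistorForm k (Function.update v (Sum.inr s) (markerRow Z q)) =
      twistor Z Y (Function.update a s q) := by
    rw [twistor_eq_twistorForm]
    congr 1
    ext t : 1
    rcases t with t | t
    · rw [Function.update_of_ne (by simp)]
      rfl
    · change _ = markerRow Z (Function.update a s q t)
      by_cases hts : t = s
      · subst hts
        simp
      · rw [Function.update_of_ne (by simpa using hts), Function.update_of_ne hts]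
        rfl
  rw [show v (Sum.inl l) = Y l from rfl, h, AlternatingMap.map_update_add,
    AlternatingMap.map_update_sum, AlternatingMap.map_update_smul, h2] at h0
  simp only [h1, Finset.sum_ite_eq', Finset.mem_univ, if_true, smul_eq_mul] at h0
  linarith

namespace ChordDiagram

variable {n k : ℕ} {D : ChordDiagram n k} {α β γ δ ε : Fin k → ℝ}

theorem sum_ite_mul_eq_markerRow (Z : Matrix (Fin n) (Fin (k + 4)) ℝ) {p : ℕ} (hp : 1 ≤ p)
    (x : ℝ) (b : Fin (k + 4)) :
    ∑ a : Fin n, (if (a : ℕ) + 1 = p then x else 0) * Z a b = x * markerRow Z p b := by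
  by_cases h : p - 1 < n
  · rw [Finset.sum_eq_single ⟨p - 1, h⟩]
    · simp [markerRow, h, Nat.sub_add_cancel hp]
    · intro a _ ha
      rw [if_neg (fun he => ha (Fin.ext (by simp; omega))), zero_mul]
    · simp
  · simp only [markerRow, h, dif_neg, not_false_eq_true, Pi.zero_apply, mul_zero]
    exact Finset.sum_eq_zero fun a _ => by rw [if_neg (by omega), zero_mul]

theorem dominoMatrix_mul_of_isTop (Z : Matrix (Fin n) (Fin (k + 4)) ℝ) {l : Fin k}
    (hl : D.IsTop l) :
    (D.dominoMatrix α β γ δ ε * Z) l =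
      (∑ t, ![α l, β l, γ l, δ l] t •
        markerRow Z (![D.tail l, D.tail l + 1, D.head l, D.head l + 1] t)) +
        ε l • markerRow Z n := by
  ext b
  have h := D.one_le_tail l
  have h' := tail_lt_head (D := D) l
  have h'' := head_lt (D := D) l
  have hp : ∀ m, ¬ D.IsParent m l := fun m hm => hm.not_isTop hl
  simp only [Matrix.mul_apply, dominoMatrix, Matrix.of_apply, hp, if_false, Finset.sum_const_zero,
    add_zero, hl, true_and, add_mul, Finset.sum_add_distrib]
  rw [sum_ite_mul_eq_markerRow Z h, sum_ite_mul_eq_markerRow Z (by omega),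
    sum_ite_mul_eq_markerRow Z (by omega), sum_ite_mul_eq_markerRow Z (by omega),
    sum_ite_mul_eq_markerRow Z (by omega)]
  simp [Fin.sum_univ_four]

theorem SignRules.twistor_consecutive_pos (hs : D.SignRules α β γ δ ε)
    {Z : Matrix (Fin n) (Fin (k + 4)) ℝ} (hZ : IsPositiveMatrix Z) {i j : ℕ} (hi : 1 ≤ i)
    (hij : i + 1 < j) (hj : j + 1 ≤ n) :
    0 < twistor Z (D.dominoMatrix α β γ δ ε * Z) ![i, i + 1, j, j + 1] := by
  have hQ : StrictMono ![i, i + 1, j, j + 1] := by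
    rw [Fin.strictMono_iff_lt_succ]
    intro u
    fin_cases u <;> simp [hij]
  obtain ⟨σ, g, hσ, hg, hgQ, hgσ⟩ := hs.exists_representatives hQ.injective
  have h := hs.twistor_pos hZ hQ (τ := 1) (fun u => by fin_cases u <;> simp <;> omega)
    (fun p P hp hpn hP hPQ hPn => ?_) hσ hg hgQ hgσ
  · simpa using h
  · have h0 := hPn 0 1
    have h2 := hPn 2 3
    have h1 := hPQ 1
    have h3 := hPQ 3
    simp only [Matrix.cons_val] at h0 h1 h2 h3
    simp only [Fin.prod_univ_four, Matrix.cons_val]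
    have e0 : (i < p ∨ i = p ∧ P) ↔ (i + 1 < p ∨ i + 1 = p ∧ P) := by grind
    have e2 : (j < p ∨ j = p ∧ P) ↔ (j + 1 < p ∨ j + 1 = p ∧ P) := by grind
    simp only [e0, e2]
    by_cases hA : i + 1 < p ∨ i + 1 = p ∧ P <;> by_cases hB : j + 1 < p ∨ j + 1 = p ∧ P <;>
      simp [hA, hB]

theorem SignRules.twistor_boundary_pos (hs : D.SignRules α β γ δ ε)
    {Z : Matrix (Fin n) (Fin (k + 4)) ℝ} (hZ : IsPositiveMatrix Z) {i : ℕ} (hi : 2 ≤ i)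
    (hin : i + 1 < n) :
    0 < (-1 : ℝ) ^ k * twistor Z (D.dominoMatrix α β γ δ ε * Z) ![1, i, i + 1, n] := by
  have hQ : StrictMono ![1, i, i + 1, n] := by
    rw [Fin.strictMono_iff_lt_succ]
    intro u
    fin_cases u <;> simp <;> omega
  obtain ⟨σ, g, hσ, hg, hgQ, hgσ⟩ := hs.exists_representatives hQ.injective
  refine hs.twistor_pos hZ hQ (fun u => by fin_cases u <;> simp <;> omega)
    (fun p P hp hpn hP hPQ hPn => ?_) hσ hg hgQ hgσ
  have h0 := hPn 1 2
  have h1 := hPQ 0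
  have h2 := hPQ 2
  have h3 := hPQ 3
  simp only [Matrix.cons_val] at h0 h1 h2 h3
  simp only [Fin.prod_univ_four, Matrix.cons_val]
  have e0 : 1 < p ∨ 1 = p ∧ P := by grind
  have e1 : (i < p ∨ i = p ∧ P) ↔ (i + 1 < p ∨ i + 1 = p ∧ P) := by grind
  have e3 : ¬ (n < p ∨ n = p ∧ P) := by grind
  simp only [e0, e1, e3]
  by_cases hA : i + 1 < p ∨ i + 1 = p ∧ P <;> simp [hA]

theorem SignRules.twistor_top_pos (hs : D.SignRules α β γ δ ε)
    {Z : Matrix (Fin n) (Fin (k + 4)) ℝ} (hZ : IsPositiveMatrix Z) {l : Fin k} (hl : D.IsTop l)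
    (p : Fin 5) :
    0 < ![((-1 : ℝ) ^ D.behind l), -((-1 : ℝ) ^ D.behind l), ((-1 : ℝ) ^ (D.behind l + D.below l)),
        -((-1 : ℝ) ^ (D.behind l + D.below l)), 1] p *
      twistor Z (D.dominoMatrix α β γ δ ε * Z)
        (fun t => ![D.tail l, D.tail l + 1, D.head l, D.head l + 1, n] (p.succAbove t)) := by
  set Y := D.dominoMatrix α β γ δ ε * Z with hY
  set Q := ![D.tail l, D.tail l + 1, D.head l, D.head l + 1] with hQ
  have hpos : 0 < twistor Z Y Q := hs.twistor_consecutive_pos hZ (D.one_le_tail l)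
    (D.tail_add_two_le_head l) (D.head_add_two_le l |> Nat.le_of_succ_le)
  obtain ⟨hα, hβ, hγ, hδ, hε, -⟩ := hs
  have hexch := twistor_exchange (dominoMatrix_mul_of_isTop (α := α) (β := β) (γ := γ) (δ := δ)
    (ε := ε) Z hl)
  have key : ∀ (s : Fin 4) (π : Equiv.Perm (Fin 4)) (a : Fin 4 → ℕ) (y : ℝ),
      a = Function.update Q s n ∘ π →
      0 < -(y * ((Equiv.Perm.sign π : ℤ) : ℝ) * ![α l, β l, γ l, δ l] s) →
      0 < (-1 : ℝ) ^ D.behind l * y * twistor Z Y a := by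
    intro s π a y ha hy
    have h1 : 0 < (-1 : ℝ) ^ D.behind l * ε l * ((-1 : ℝ) ^ D.behind l * y * twistor Z Y a) := by
      have h2 : (-1 : ℝ) ^ D.behind l * (-1 : ℝ) ^ D.behind l = 1 := by
        rw [← mul_pow]
        norm_num
      rw [ha, twistor_comp_perm]
      have h3 := hexch s
      have h4 := mul_pos hy hpos
      calc 0 < _ := h4
        _ = y * ((Equiv.Perm.sign π : ℤ) : ℝ) * (ε l * twistor Z Y (Function.update Q s n)) := by
          rw [h3]
          ring
        _ = _ := by
          linear_combination (- y * ((Equiv.Perm.sign π : ℤ) : ℝ) * ε l *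
            twistor Z Y (Function.update Q s n)) * h2
    exact (mul_pos_iff_of_pos_left (hε l hl)).1 h1
  have hγ' := hγ l
  have hδ' := hδ l
  fin_cases p
  · have := key 0 (finRotate 4) (fun t => ![D.tail l, D.tail l + 1, D.head l, D.head l + 1, n]
      ((0 : Fin 5).succAbove t)) 1 (by ext t; fin_cases t <;> rfl) (by
        rw [sign_finRotate]
        simpa using hα l)
    simpa using this
  · have := key 1 (finRotate 4 * Equiv.swap 3 0) (fun t => ![D.tail l, D.tail l + 1, D.head l,
      D.head l + 1, n] ((1 : Fin 5).succAbove t)) (-1) (by ext t; fin_cases t <;> rfl) (by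
        rw [Equiv.Perm.sign_mul, sign_finRotate, Equiv.Perm.sign_swap (by decide)]
        simpa using hβ l)
    simpa using this
  · have := key 2 (Equiv.swap 2 3) (fun t => ![D.tail l, D.tail l + 1, D.head l, D.head l + 1, n]
      ((2 : Fin 5).succAbove t)) ((-1) ^ D.below l) (by ext t; fin_cases t <;> rfl) (by
        rw [Equiv.Perm.sign_swap (by decide)]
        simpa using hγ l)
    simpa [pow_add] using this
  · have := key 3 1 (fun t => ![D.tail l, D.tail l + 1, D.head l, D.head l + 1, n]
      ((3 : Fin 5).succAbove t)) (-(-1) ^ D.below l) (by ext t; fin_cases t <;> rfl) (by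
        simpa using hδ l)
    simpa [pow_add] using this
  · have : (fun t => ![D.tail l, D.tail l + 1, D.head l, D.head l + 1, n]
      ((4 : Fin 5).succAbove t)) = Q := by ext t; fin_cases t <;> rfl
    simpa [this] using hpos

end ChordDiagram

/-- Let `C` be a domino matrix of a chord diagram `D` satisfying the
sign rules, `Z` positive, `Y = C * Z`.  (1) `⟨Y i (i+1) j (j+1)⟩ > 0` for all
`1 ≤ i < i+1 < j < j+1 ≤ n`, and `(-1)^k · ⟨Y 1 i (i+1) n⟩ > 0` for `2 ≤ i`,
`i + 1 ≤ n - 1`.  (2) If `c_l = (i, i+1, j, j+1)` is a top chord, the twistor on the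
four markers `{i, i+1, j, j+1, n} ∖ {p}` (in increasing order) is nonzero with sign
`(-1)^behind, -(-1)^behind, (-1)^(behind+below), -(-1)^(behind+below), +1` according to
whether `p = i, i+1, j, j+1, n` (where `behind = k - l` and `below = below(c_l)`). -/
theorem twistor_signs_on_bcfw_cell
    (n k : ℕ) (hk : 1 ≤ k) (hn : k + 4 ≤ n)
    (D : ChordDiagram n k) (α β γ δ ε : Fin k → ℝ) (hs : D.SignRules α β γ δ ε)
    (Z : Matrix (Fin n) (Fin (k + 4)) ℝ) (hZ : IsPositiveMatrix Z)
    (Y : Matrix (Fin k) (Fin (k + 4)) ℝ) (hY : Y = D.dominoMatrix α β γ δ ε * Z) :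
    (∀ i j : ℕ, 1 ≤ i → i + 1 < j → j + 1 ≤ n →
        0 < twistor Z Y ![i, i + 1, j, j + 1]) ∧
    (∀ i : ℕ, 2 ≤ i → i + 1 ≤ n - 1 →
        0 < (-1 : ℝ) ^ k * twistor Z Y ![1, i, i + 1, n]) ∧
    (∀ l : Fin k, D.IsTop l → ∀ p : Fin 5,
        0 < ![((-1 : ℝ) ^ D.behind l), -((-1 : ℝ) ^ D.behind l),
              ((-1 : ℝ) ^ (D.behind l + D.below l)),
              -((-1 : ℝ) ^ (D.behind l + D.below l)), 1] p *
            twistor Z Y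
              (fun t => ![D.tail l, D.tail l + 1, D.head l, D.head l + 1, n]
                (p.succAbove t))) := by
  subst hY
  exact ⟨fun i j hi hij hj => hs.twistor_consecutive_pos hZ hi hij hj,
    fun i hi hin => hs.twistor_boundary_pos hZ hi (by omega),
    fun l hl p => hs.twistor_top_pos hZ hl p⟩

end
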